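/- arXiv:2411.09941 — 2 statements merged into one kernel-verified Lean document; each statement's English description precedes it below -/
import Mathlib

section
/- Let u be a positive classical solution of −Δu + (−Δ)^s u + u = u^p in ℝⁿ with u(x) → 0 at infinity. Then there exist constants 0 < C₁ ≤ C₂ such that for all |x| ≥ 1: C₁/|x|^{n+2s} ≤ u(x) ≤ C₂/|x|^{n+2s}. -/
open MeasureTheory Filter Set
open scoped Topology

noncomputable section

/-- The classical Laplacian of `u` at `x`, as the trace of the second derivative. -/
def lapl (n : ℕ) (u : EuclideanSpace ℝ (Fin n) → ℝ) (x : EuclideanSpace ℝ (Fin n)) : ℝ :=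
  ∑ i : Fin n,
    fderiv ℝ (fun y => fderiv ℝ u y (EuclideanSpace.single i 1)) x (EuclideanSpace.single i 1)

/-- `L` is the value at `x` of the (un-normalized) fractional Laplacian of `u`, defined as the
principal value `P.V. ∫ (u(x) − u(y)) / |x − y|^{n+2s} dy`. -/
def IsFracLapAt (n : ℕ) (s : ℝ) (u : EuclideanSpace ℝ (Fin n) → ℝ)
    (x : EuclideanSpace ℝ (Fin n)) (L : ℝ) : Prop :=
  Filter.Tendsto
    (fun ε : ℝ => ∫ y in {y : EuclideanSpace ℝ (Fin n) | ε ≤ dist x y},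
      (u x - u y) / dist x y ^ ((n : ℝ) + 2 * s))
    (nhdsWithin 0 (Set.Ioi 0)) (nhds L)


theorem bern_up {a : ℝ} (ha : 1 < a) {r : ℝ} (hr : 1/3 ≤ r) :
    r ^ (-a) ≤ 1 - a * (r - 1) + (2 * a^2 + 3^a * (4 * a^2)) * (r-1)^2 := by
  have hr0 : 0 < r := by linarith
  have h3 : (0:ℝ) < 3^a := by positivity
  by_cases h : 1/2 ≤ 1 + a * (r-1)
  · have hb : 1 + a * (r-1) ≤ r ^ a := by
      have := one_add_mul_self_le_rpow_one_add (s := r - 1) (by linarith) (p := a) ha.le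
      simpa using this
    have h1 : r ^ (-a) ≤ (1 + a * (r-1))⁻¹ := by
      rw [Real.rpow_neg hr0.le]
      exact inv_anti₀ (by linarith) hb
    have h2 : (1 + a * (r-1))⁻¹ ≤ 1 - a * (r - 1) + 2 * a^2 * (r-1)^2 := by
      rw [inv_le_iff_one_le_mul₀ (by linarith)]
      nlinarith [mul_nonneg (sq_nonneg (a * (r-1))) (by linarith : 0 ≤ 1 + a * (r-1) - 1/2)]
    have : 0 ≤ 3^a * (4 * a^2) * (r-1)^2 := by positivity
    nlinarith
  · push Not at h
    have h1 : r ^ (-a) ≤ 3 ^ a := by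
      rw [Real.rpow_neg hr0.le, ← Real.inv_rpow hr0.le]
      apply Real.rpow_le_rpow (by positivity) _ (by linarith)
      rw [inv_le_comm₀ hr0 (by norm_num)]; linarith
    have h2 : 1 ≤ 4 * a^2 * (r-1)^2 := by nlinarith
    have h3' : 3^a ≤ 3^a * (4 * a^2) * (r-1)^2 := by nlinarith
    have : 0 ≤ 2 * a^2 * (r-1)^2 := by positivity
    nlinarith

theorem bern_lo {a : ℝ} (ha : 1 < a) {r : ℝ} (hr0 : 0 < r) :
    1 - a * (r - 1) ≤ r ^ (-a) := by
  have h := one_add_mul_self_le_rpow_one_add (s := r⁻¹ - 1) (by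
    have := inv_pos.2 hr0; linarith) (p := a) ha.le
  have e : (1 + (r⁻¹ - 1)) ^ a = r ^ (-a) := by
    rw [Real.rpow_neg hr0.le, ← Real.inv_rpow hr0.le]; congr 1; ring
  rw [e] at h
  refine le_trans ?_ h
  have : 1 + a * (r⁻¹ - 1) - (1 - a * (r-1)) = a * (r-1)^2 * r⁻¹ := by
    field_simp; ring
  have h2 : 0 ≤ a * (r-1)^2 * r⁻¹ := by positivity
  linarith

section Aux

variable {n : ℕ}

def vfun (a : ℝ) (x : EuclideanSpace ℝ (Fin n)) : ℝ := (1 + ‖x‖^2) ^ (-a)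

def lfun (a : ℝ) (x z : EuclideanSpace ℝ (Fin n)) : ℝ := 2 * a * inner ℝ x z / (1 + ‖x‖^2)

theorem vfun_pos (a : ℝ) (x : EuclideanSpace ℝ (Fin n)) : 0 < vfun a x := by
  unfold vfun; positivity

theorem vfun_le_one {a : ℝ} (ha : 1 < a) (x : EuclideanSpace ℝ (Fin n)) : vfun a x ≤ 1 := by
  unfold vfun
  apply Real.rpow_le_one_of_one_le_of_nonpos
  · nlinarith [sq_nonneg ‖x‖]
  · linarith

theorem vfun_cont (a : ℝ) : Continuous (vfun (n := n) a) := by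
  unfold vfun
  apply Continuous.rpow_const (by fun_prop)
  intro x; left; positivity

theorem vtaylor {a : ℝ} (ha : 1 < a) : ∃ C : ℝ, 1 ≤ C ∧ ∀ x z : EuclideanSpace ℝ (Fin n), ‖z‖ ≤ 1 →
    vfun a (x + z) ≤ vfun a x * (1 - lfun a x z + C * ‖z‖^2) ∧
    vfun a x * (1 - lfun a x z - C * ‖z‖^2) ≤ vfun a (x + z) := by
  set C0 : ℝ := 2 * a^2 + 3^a * (4 * a^2) with hC0
  have hC0p : 0 < C0 := by positivity
  refine ⟨4 * C0 + a, by linarith, fun x z hz => ?_⟩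
  have hx0 := norm_nonneg x
  have hz0 := norm_nonneg z
  have hX : 0 < 1 + ‖x‖^2 := by positivity
  have hnorm : ‖x + z‖^2 = ‖x‖^2 + 2 * inner ℝ x z + ‖z‖^2 := norm_add_sq_real x z
  set r : ℝ := (1 + ‖x+z‖^2) / (1 + ‖x‖^2) with hr
  have hrpos : 0 < r := by positivity
  have hr3 : 1/3 ≤ r := by
    rw [hr, le_div_iff₀ hX]
    have : ‖x‖ ≤ ‖x + z‖ + ‖z‖ := by
      have := norm_sub_le (x+z) z
      simpa using this
    nlinarith [norm_nonneg (x+z), sq_nonneg (‖x+z‖ - 1), sq_nonneg (‖x + z‖ - ‖z‖)]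
  have hv : vfun a (x+z) = vfun a x * r ^ (-a) := by
    unfold vfun
    rw [← Real.mul_rpow hX.le hrpos.le, hr, mul_div_cancel₀ _ hX.ne']
  have hin := abs_le.1 (abs_real_inner_le_norm x z)
  have ht : r - 1 = (2 * inner ℝ x z + ‖z‖^2) / (1 + ‖x‖^2) := by
    rw [hr, hnorm]; field_simp; ring
  have hat : a * (r - 1) = lfun a x z + a * ‖z‖^2 / (1 + ‖x‖^2) := by
    rw [ht, lfun]; field_simp
  have hq0 : 0 ≤ a * ‖z‖^2 / (1 + ‖x‖^2) := by positivity
  have hq1 : a * ‖z‖^2 / (1 + ‖x‖^2) ≤ a * ‖z‖^2 := by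
    apply div_le_self (by positivity); nlinarith
  have hxx : 2 * ‖x‖ ≤ 1 + ‖x‖^2 := by nlinarith [sq_nonneg (‖x‖ - 1)]
  have hz2 : ‖z‖^2 ≤ ‖z‖ := by nlinarith
  have hz3 : ‖z‖^2 ≤ ‖z‖ * (1 + ‖x‖^2) := by nlinarith [mul_nonneg hz0 (sq_nonneg ‖x‖)]
  have ht2 : (r-1)^2 ≤ 4 * ‖z‖^2 := by
    have : |r - 1| ≤ 2 * ‖z‖ := by
      rw [ht, abs_le, div_le_iff₀ hX, le_div_iff₀ hX]
      constructor <;> nlinarith [mul_le_mul_of_nonneg_left hxx hz0, sq_nonneg ‖z‖, mul_nonneg hz0 hX.le]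
    have h4 := sq_le_sq' (abs_le.1 this).1 (abs_le.1 this).2
    linarith [h4, mul_pow 2 ‖z‖ 2]
  have hvx := vfun_pos a x
  rw [hv]
  constructor
  · apply mul_le_mul_of_nonneg_left _ hvx.le
    have := bern_up ha hr3
    rw [← hC0] at this
    nlinarith
  · apply mul_le_mul_of_nonneg_left _ hvx.le
    have := bern_lo ha hrpos
    nlinarith [sq_nonneg ‖z‖, mul_nonneg hC0p.le (sq_nonneg ‖z‖)]

theorem second_test {g g' : ℝ → ℝ} {g2 b k : ℝ} (hg : ∀ t, HasDerivAt g (g' t) t)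
    (hg2 : HasDerivAt g' g2 0) (h : ∀ᶠ t in 𝓝 (0:ℝ), g t ≤ g 0 + b * t + k * t^2) :
    g2 ≤ 2 * k := by
  by_contra hcon
  push Not at hcon
  set h' : ℝ → ℝ := fun t => g t - b * t - k * t^2 with hh'
  have hd : ∀ t, HasDerivAt h' (g' t - b - 2 * k * t) t := by
    intro t
    have := ((hg t).sub ((hasDerivAt_id t).const_mul b)).sub (((hasDerivAt_id t).pow 2).const_mul k)
    refine HasDerivAt.congr_deriv (f := h') this ?_
    simp; ring
  have hdd : deriv h' = fun t => g' t - b - 2 * k * t := funext fun t => (hd t).deriv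
  have hdd0 : HasDerivAt (deriv h') (g2 - 2 * k) 0 := by
    rw [hdd]
    have := (hg2.sub_const b).sub ((hasDerivAt_id (0:ℝ)).const_mul (2*k))
    refine HasDerivAt.congr_deriv (f := fun t => g' t - b - 2 * k * t) this ?_
    simp
  have hmax : IsLocalMax h' 0 := by
    filter_upwards [h] with t ht
    simp only [hh']; linarith
  have hz : deriv h' 0 = 0 := hmax.deriv_eq_zero
  have hmin : IsLocalMin h' 0 := isLocalMin_of_deriv_deriv_pos (by rw [hdd0.deriv]; linarith) hz
    (hd 0).continuousAt
  have hc : h' =ᶠ[𝓝 0] fun _ => h' 0 := by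
    filter_upwards [hmax, hmin] with t h1 h2
    exact le_antisymm h1 h2
  have hc2 : deriv h' =ᶠ[𝓝 0] fun _ => 0 := by
    have := hc.deriv
    simpa using this
  have := hc2.deriv_eq
  rw [hdd0.deriv] at this
  simp at this
  linarith


def Sset (n : ℕ) (ε : ℝ) : Set (EuclideanSpace ℝ (Fin n)) := {z | ε ≤ ‖z‖}

theorem Sset_meas (ε : ℝ) : MeasurableSet (Sset n ε) :=
  (isClosed_le continuous_const continuous_norm).measurableSet

theorem far_int {m ε : ℝ} (hm : (n:ℝ) < m) (hε : 0 < ε) :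
    IntegrableOn (fun z : EuclideanSpace ℝ (Fin n) => (‖z‖^m)⁻¹) (Sset n ε) := by
  have h0 : 0 < m := lt_of_le_of_lt (Nat.cast_nonneg n) hm
  have h1 : Integrable (fun z : EuclideanSpace ℝ (Fin n) => (1 + ‖z‖)^(-m)) :=
    integrable_one_add_norm (by simpa using hm)
  refine (h1.const_mul ((1/ε+1)^m)).integrableOn.mono' ?_ ?_
  · exact Measurable.aestronglyMeasurable (by fun_prop)
  · refine (ae_restrict_iff' (Sset_meas ε)).2 (Eventually.of_forall fun z hz => ?_)
    have hz : ε ≤ ‖z‖ := hz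
    have hz0 : 0 < ‖z‖ := hε.trans_le hz
    rw [Real.norm_of_nonneg (by positivity), Real.rpow_neg (by positivity), ← div_eq_mul_inv,
      le_div_iff₀ (by positivity), inv_mul_le_iff₀ (by positivity), mul_comm,
      ← Real.mul_rpow (by positivity) (by positivity)]
    apply Real.rpow_le_rpow (by positivity) _ h0.le
    have : 1 ≤ 1/ε * ‖z‖ := by rw [one_div, le_inv_mul_iff₀ hε]; linarith
    linarith

theorem near_int {m : ℝ} (hn : 2 ≤ n) (hm : m < (n:ℝ) + 2) :
    IntegrableOn (fun z : EuclideanSpace ℝ (Fin n) => ‖z‖^2 / ‖z‖^m) (Metric.ball 0 1) := by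
  have : Nontrivial (EuclideanSpace ℝ (Fin n)) := by
    apply Module.nontrivial_of_finrank_pos (R := ℝ); simp; omega
  refine (integrableOn_fun_norm_addHaar volume (f := fun r : ℝ => r^2 / r^m)).2 ?_
  have h := (intervalIntegral.integrableOn_Ioo_rpow_iff (s := (n:ℝ)+1-m) (t := 1) one_pos).2 (by linarith)
  refine h.congr_fun (fun y hy => ?_) measurableSet_Ioo
  have hy0 : 0 < y := hy.1
  simp only [finrank_euclideanSpace, Fintype.card_fin, smul_eq_mul]
  rw [Real.rpow_sub hy0, ← mul_div_assoc, ← pow_add, ← Real.rpow_natCast]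
  congr 2
  rw [show n - 1 + 2 = n + 1 by omega]; push_cast; ring

theorem bdd_int {m ε B : ℝ} (hm : (n:ℝ) < m) (hε : 0 < ε) {T : Set (EuclideanSpace ℝ (Fin n))}
    (hT : T ⊆ Sset n ε) (hTm : MeasurableSet T) {f : EuclideanSpace ℝ (Fin n) → ℝ}
    (hf : Continuous f) (hB : ∀ z ∈ T, |f z| ≤ B) :
    IntegrableOn (fun z => f z / ‖z‖^m) T := by
  refine (((far_int hm hε).mono_set hT).const_mul B).mono' ?_ ?_
  · exact (Measurable.aestronglyMeasurable (by have := hf.measurable; fun_prop))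
  · refine (ae_restrict_iff' hTm).2 (Eventually.of_forall fun z hz => ?_)
    have : 0 ≤ ‖z‖^m := by positivity
    rw [norm_div, Real.norm_eq_abs, Real.norm_of_nonneg this, div_eq_mul_inv]
    exact mul_le_mul_of_nonneg_right (hB z hz) (by positivity)

theorem lfun_bound (a : ℝ) (x z : EuclideanSpace ℝ (Fin n)) (hz : ‖z‖ ≤ 1) :
    |lfun a x z| ≤ 2 * |a| * ‖x‖ := by
  unfold lfun
  rw [abs_div, abs_mul, abs_mul, abs_two, abs_of_pos (by positivity : 0 < 1 + ‖x‖^2)]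
  refine (div_le_self (by positivity) (by nlinarith [sq_nonneg ‖x‖])).trans ?_
  apply mul_le_mul_of_nonneg_left _ (by positivity)
  refine (abs_real_inner_le_norm x z).trans ?_
  nlinarith [norm_nonneg x]

def Nset (n : ℕ) (ε : ℝ) : Set (EuclideanSpace ℝ (Fin n)) := Sset n ε ∩ Metric.ball 0 1

theorem Nset_meas (ε : ℝ) : MeasurableSet (Nset n ε) := (Sset_meas ε).inter measurableSet_ball

theorem Sset_eq {ε : ℝ} (hε : ε < 1) : Sset n ε = Nset n ε ∪ Sset n 1 := by
  ext z
  simp only [Nset, Sset, mem_union, mem_inter_iff, mem_ofPred_eq, Metric.mem_ball, dist_zero_right]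
  constructor
  · intro h
    by_cases h1 : 1 ≤ ‖z‖
    · exact Or.inr h1
    · exact Or.inl ⟨h, not_le.1 h1⟩
  · rintro (h | h)
    · exact h.1
    · linarith

theorem NS_disj {ε : ℝ} : Disjoint (Nset n ε) (Sset n 1) := by
  rw [Set.disjoint_left]
  intro z hz h1
  simp only [Nset, Sset, mem_inter_iff, mem_ofPred_eq, Metric.mem_ball, dist_zero_right] at hz h1
  linarith [hz.2]

theorem odd_zero (a m ε : ℝ) (x : EuclideanSpace ℝ (Fin n)) :
    ∫ z in Nset n ε, lfun a x z / ‖z‖^m = 0 := by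
  rw [← integral_indicator (Nset_meas ε)]
  set g := (Nset n ε).indicator fun z => lfun a x z / ‖z‖^m with hg
  have h : ∀ z, g (-z) = - g z := by
    intro z
    simp only [hg, indicator]
    have : -z ∈ Nset n ε ↔ z ∈ Nset n ε := by simp [Nset, Sset]
    by_cases hz : z ∈ Nset n ε
    · rw [if_pos (this.2 hz), if_pos hz]; simp [lfun]; ring
    · rw [if_neg (fun h => hz (this.1 h)), if_neg hz]; simp
  have h2 := integral_neg_eq_self g volume
  simp only [h, integral_neg] at h2
  linarith

theorem v_int {a : ℝ} (ha : (n:ℝ) < 2 * a) : Integrable (vfun (n := n) a) := by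
  have := integrable_rpow_neg_one_add_norm_sq (E := EuclideanSpace ℝ (Fin n)) (μ := volume)
    (r := 2 * a) (by simpa using ha)
  refine this.congr (Eventually.of_forall fun x => ?_)
  simp only [vfun]; congr 1; ring

theorem v_conv {a : ℝ} (ha : 1 < a) (x z : EuclideanSpace ℝ (Fin n)) (hz : 1 ≤ ‖z‖) :
    vfun a (x+z) / ‖z‖^(2*a) ≤ 8^a * vfun a x * (vfun a (x+z) + vfun a z) := by
  have hz0 : 0 < ‖z‖ := by linarith
  have h1 : (‖z‖^(2*a))⁻¹ ≤ 2^a * vfun a z := by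
    unfold vfun
    rw [Real.rpow_neg (by positivity), ← div_eq_mul_inv, le_div_iff₀ (by positivity),
      inv_mul_le_iff₀ (by positivity), Real.rpow_mul hz0.le, ← Real.mul_rpow (by positivity) (by positivity)]
    apply Real.rpow_le_rpow (by positivity) _ (by linarith)
    rw [Real.rpow_two]; nlinarith
  have key : ∀ p q : ℝ, 0 < p → 0 < q → 1 + ‖x‖^2 ≤ 2 * p + 2 * q →
      p^(-a) * q^(-a) ≤ 4^a * vfun a x * (p^(-a) + q^(-a)) := by
    intro p q hp hq h
    have aux : ∀ p : ℝ, 0 < p → 1 + ‖x‖^2 ≤ 4 * p → p^(-a) ≤ 4^a * vfun a x := by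
      intro p hp h
      unfold vfun
      rw [Real.rpow_neg (by positivity), Real.rpow_neg (by positivity), ← div_eq_mul_inv, le_div_iff₀ (by positivity),
        inv_mul_le_iff₀ (by positivity), ← Real.mul_rpow (by positivity) (by positivity)]
      apply Real.rpow_le_rpow (by positivity) _ (by linarith)
      linarith
    have hpa : 0 < p^(-a) := by positivity
    have hqa : 0 < q^(-a) := by positivity
    have hV : 0 < 4^a * vfun a x := mul_pos (by positivity) (vfun_pos a x)
    rcases le_total p q with h' | h'
    · have := aux q hq (by linarith)
      nlinarith [mul_le_mul_of_nonneg_left this hpa.le, mul_pos hV hqa]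
    · have := aux p hp (by linarith)
      nlinarith [mul_le_mul_of_nonneg_right this hqa.le, mul_pos hV hpa]
  have h2 := key (1 + ‖x+z‖^2) (1 + ‖z‖^2) (by positivity) (by positivity) (by
    have : ‖x‖ ≤ ‖x + z‖ + ‖z‖ := by
      have := norm_sub_le (x+z) z
      simpa using this
    nlinarith [norm_nonneg x, sq_nonneg (‖x + z‖ - ‖z‖)])
  change vfun a (x+z) * vfun a z ≤ 4^a * vfun a x * (vfun a (x+z) + vfun a z) at h2
  have e : (8:ℝ)^a = 2^a * 4^a := by
    rw [← Real.mul_rpow (by norm_num) (by norm_num)]; norm_num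
  calc vfun a (x+z) / ‖z‖^(2*a) = vfun a (x+z) * (‖z‖^(2*a))⁻¹ := div_eq_mul_inv _ _
    _ ≤ vfun a (x+z) * (2^a * vfun a z) := mul_le_mul_of_nonneg_left h1 (vfun_pos _ _).le
    _ = 2^a * (vfun a (x+z) * vfun a z) := by ring
    _ ≤ 2^a * (4^a * vfun a x * (vfun a (x+z) + vfun a z)) := mul_le_mul_of_nonneg_left h2 (by positivity)
    _ = _ := by rw [e]; ring

theorem lfun_cont (a : ℝ) (x : EuclideanSpace ℝ (Fin n)) : Continuous (lfun a x) := by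
  unfold lfun; fun_prop

theorem vdiff_bound {a : ℝ} (ha : 1 < a) (x y : EuclideanSpace ℝ (Fin n)) :
    |vfun a x - vfun a y| ≤ 1 := by
  rw [abs_le]
  constructor <;> linarith [vfun_pos a x, vfun_pos a y, vfun_le_one ha x, vfun_le_one ha y]

set_option maxHeartbeats 1000000 in
theorem I_bounds {a : ℝ} (hn : 2 ≤ n) (ha1 : 1 < a) (ha : (n:ℝ) < 2 * a) (ha2 : 2 * a < (n:ℝ) + 2) :
    ∃ K : ℝ, 0 < K ∧ ∀ ε, 0 < ε → ε < 1 → ∀ x : EuclideanSpace ℝ (Fin n),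
      -(K * vfun a x) ≤ ∫ z in Sset n ε, (vfun a x - vfun a (x+z)) / ‖z‖^(2*a) ∧
      ∫ z in Sset n ε, (vfun a x - vfun a (x+z)) / ‖z‖^(2*a) ≤ K * vfun a x := by
  obtain ⟨C, hC1, hC⟩ := vtaylor (n := n) ha1
  set J := ∫ z in Metric.ball (0 : EuclideanSpace ℝ (Fin n)) 1, ‖z‖^2 / ‖z‖^(2*a) with hJ
  have hJ0 : 0 ≤ J := integral_nonneg fun z => by positivity
  set Q := ∫ z, vfun (n := n) a z with hQ
  have hQ0 : 0 ≤ Q := integral_nonneg fun z => (vfun_pos a z).le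
  set W := ∫ z in Sset n 1, (‖z‖^(2*a))⁻¹ with hW
  have hW0 : 0 ≤ W := integral_nonneg fun z => by positivity
  refine ⟨C * J + 8^a * (2 * Q) + W + 1, by positivity, fun ε hε hε1 x => ?_⟩
  have hvx := vfun_pos a x
  have hcont : Continuous fun z => vfun a x - vfun a (x+z) :=
    continuous_const.sub ((vfun_cont a).comp (continuous_const.add continuous_id))
  have hNS : Nset n ε ⊆ Sset n ε := inter_subset_left
  have hSS : Sset n 1 ⊆ Sset n ε := fun z (hz : 1 ≤ ‖z‖) => hε1.le.trans hz
  have hNb : ∀ z ∈ Nset n ε, ‖z‖ ≤ 1 := fun z hz => by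
    have := hz.2; simp at this; exact this.le
  have hiN := bdd_int ha hε hNS (Nset_meas ε) hcont (B := 1) (fun z _ => vdiff_bound ha1 _ _)
  have hiS := bdd_int ha hε hSS (Sset_meas 1) hcont (B := 1) (fun z _ => vdiff_bound ha1 _ _)
  rw [Sset_eq hε1, setIntegral_union NS_disj (Sset_meas 1) hiN hiS]
  have hil := bdd_int ha hε hNS (Nset_meas ε) (lfun_cont a x) (fun z hz => lfun_bound a x z (hNb z hz))
  have hin := near_int (m := 2 * a) hn ha2
  have hinN : IntegrableOn (fun z : EuclideanSpace ℝ (Fin n) => ‖z‖^2 / ‖z‖^(2*a)) (Nset n ε) :=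
    hin.mono_set inter_subset_right
  have hJN : ∫ z in Nset n ε, ‖z‖^2 / ‖z‖^(2*a) ≤ J :=
    setIntegral_mono_set hin (Eventually.of_forall fun z => by positivity)
      (Eventually.of_forall (inter_subset_right : Nset n ε ⊆ _))
  have hlo : -(C * J * vfun a x) ≤ ∫ z in Nset n ε, (vfun a x - vfun a (x+z)) / ‖z‖^(2*a) := by
    have e : ∫ z in Nset n ε, (vfun a x * (lfun a x z / ‖z‖^(2*a)) - (vfun a x * C) * (‖z‖^2 / ‖z‖^(2*a)))
        = - (vfun a x * C * ∫ z in Nset n ε, ‖z‖^2 / ‖z‖^(2*a)) := by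
      rw [integral_sub (hil.const_mul _) (hinN.const_mul _), integral_const_mul, integral_const_mul, odd_zero]
      ring
    calc -(C * J * vfun a x) ≤ _ := by
          have := mul_le_mul_of_nonneg_left hJN (by positivity : 0 ≤ vfun a x * C)
          linarith
      _ = _ := e.symm
      _ ≤ _ := by
        apply setIntegral_mono_on ((hil.const_mul _).sub (hinN.const_mul _)) hiN (Nset_meas ε)
        intro z hz
        have := (hC x z (hNb z hz)).1
        simp only [Pi.sub_apply]
        rw [← mul_div_assoc, ← mul_div_assoc, ← sub_div]
        apply div_le_div_of_nonneg_right _ (by positivity)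
        linarith
  have hup : ∫ z in Nset n ε, (vfun a x - vfun a (x+z)) / ‖z‖^(2*a) ≤ C * J * vfun a x := by
    have e : ∫ z in Nset n ε, (vfun a x * (lfun a x z / ‖z‖^(2*a)) + (vfun a x * C) * (‖z‖^2 / ‖z‖^(2*a)))
        = (vfun a x * C * ∫ z in Nset n ε, ‖z‖^2 / ‖z‖^(2*a)) := by
      rw [integral_add (hil.const_mul _) (hinN.const_mul _), integral_const_mul, integral_const_mul, odd_zero]
      ring
    calc _ ≤ _ := by
          apply setIntegral_mono_on hiN ((hil.const_mul _).add (hinN.const_mul _)) (Nset_meas ε)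
          intro z hz
          have := (hC x z (hNb z hz)).2
          simp only [Pi.add_apply]
          rw [← mul_div_assoc, ← mul_div_assoc, ← add_div]
          apply div_le_div_of_nonneg_right _ (by positivity)
          linarith
      _ = _ := e
      _ ≤ C * J * vfun a x := by
          have := mul_le_mul_of_nonneg_left hJN (by positivity : 0 ≤ vfun a x * C)
          linarith
  have hvi := v_int ha
  have hvi2 : Integrable fun z => vfun a (x+z) := hvi.comp_add_left x
  have hlo2 : -(8^a * (2 * Q) * vfun a x) ≤ ∫ z in Sset n 1, (vfun a x - vfun a (x+z)) / ‖z‖^(2*a) := by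
    have e : ∫ z, (8^a * vfun a x) * (vfun a (x+z) + vfun a z) = 8^a * vfun a x * (2 * Q) := by
      rw [integral_const_mul, integral_add hvi2 hvi, integral_add_left_eq_self (vfun a) x]
      ring
    have hi3 : Integrable fun z => (8^a * vfun a x) * (vfun a (x+z) + vfun a z) := (hvi2.add hvi).const_mul _
    calc -(8^a * (2 * Q) * vfun a x) = - ∫ z, (8^a * vfun a x) * (vfun a (x+z) + vfun a z) := by
          rw [e]; ring
      _ ≤ - ∫ z in Sset n 1, (8^a * vfun a x) * (vfun a (x+z) + vfun a z) := by
          apply neg_le_neg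
          apply setIntegral_le_integral hi3 (Eventually.of_forall fun z => ?_)
          have h1 := vfun_pos a (x+z)
          have h2 := vfun_pos a z
          simp only [Pi.zero_apply]; positivity
      _ = ∫ z in Sset n 1, -((8^a * vfun a x) * (vfun a (x+z) + vfun a z)) := (integral_neg _).symm
      _ ≤ _ := by
          apply setIntegral_mono_on hi3.neg.integrableOn hiS (Sset_meas 1)
          intro z hz
          have := v_conv ha1 x z hz
          rw [sub_div]
          have : 0 ≤ vfun a x / ‖z‖^(2*a) := by positivity
          simp only [Pi.neg_apply]
          linarith
  have hup2 : ∫ z in Sset n 1, (vfun a x - vfun a (x+z)) / ‖z‖^(2*a) ≤ W * vfun a x := by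
    have hi4 := (far_int (m := 2 * a) ha one_pos).const_mul (vfun a x)
    calc _ ≤ ∫ z in Sset n 1, vfun a x * (‖z‖^(2*a))⁻¹ := by
          apply setIntegral_mono_on hiS hi4 (Sset_meas 1)
          intro z hz
          rw [← div_eq_mul_inv]
          apply div_le_div_of_nonneg_right _ (by positivity)
          linarith [vfun_pos a (x+z)]
      _ = _ := by rw [integral_const_mul]; ring
  have p1 : 0 ≤ C * J * vfun a x := mul_nonneg (mul_nonneg (by linarith) hJ0) hvx.le
  have p2 : 0 ≤ 8^a * (2 * Q) * vfun a x :=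
    mul_nonneg (mul_nonneg (Real.rpow_nonneg (by norm_num) a) (by linarith)) hvx.le
  have p3 : 0 ≤ W * vfun a x := mul_nonneg hW0 hvx.le
  constructor <;> linarith


theorem lapl_touch {u : EuclideanSpace ℝ (Fin n) → ℝ} (hu : ContDiff ℝ 2 u)
    (x : EuclideanSpace ℝ (Fin n)) (k ρ : ℝ) (hρ : 0 < ρ) (b : EuclideanSpace ℝ (Fin n) → ℝ)
    (hb : ∀ (t : ℝ) z, b (t • z) = t * b z) :
    ((∀ z, ‖z‖ ≤ ρ → u (x + z) ≤ u x + b z + k * ‖z‖^2) → lapl n u x ≤ n * (2 * k)) ∧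
    ((∀ z, ‖z‖ ≤ ρ → u x + b z - k * ‖z‖^2 ≤ u (x + z)) → -(n * (2 * k)) ≤ lapl n u x) := by
  have hline : ∀ (e : EuclideanSpace ℝ (Fin n)) (t : ℝ), HasDerivAt (fun t : ℝ => x + t • e) e t := by
    intro e t
    simpa using ((hasDerivAt_id t).smul_const e).const_add x
  have hd1 : ∀ (e : EuclideanSpace ℝ (Fin n)) (t : ℝ),
      HasDerivAt (fun t : ℝ => u (x + t • e)) (fderiv ℝ u (x + t • e) e) t := by
    intro e t
    have h := (hu.differentiable (by norm_num) (x + t • e)).hasFDerivAt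
    exact h.comp_hasDerivAt t (hline e t)
  have hC1 : ∀ e : EuclideanSpace ℝ (Fin n), Differentiable ℝ (fun y => fderiv ℝ u y e) := by
    intro e
    have h := hu.fderiv_right (m := 1) (by norm_num)
    exact (h.differentiable (by norm_num)).clm_apply (differentiable_const e)
  have hd2 : ∀ (e : EuclideanSpace ℝ (Fin n)),
      HasDerivAt (fun t : ℝ => fderiv ℝ u (x + t • e) e) (fderiv ℝ (fun y => fderiv ℝ u y e) x e) 0 := by
    intro e
    have h := (hC1 e (x + (0:ℝ) • e)).hasFDerivAt
    have := h.comp_hasDerivAt (0:ℝ) (hline e 0)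
    rw [zero_smul, add_zero] at this
    exact this
  have hev : ∀ᶠ t in 𝓝 (0:ℝ), |t| ≤ ρ := by
    filter_upwards [Metric.closedBall_mem_nhds (0:ℝ) hρ] with t ht
    simpa using ht
  have hsum : ∀ c : ℝ, (n:ℝ) * c = ∑ i : Fin n, c := by intro c; simp
  constructor
  · intro h
    rw [hsum]
    apply Finset.sum_le_sum
    intro i _
    apply second_test (b := b (EuclideanSpace.single i 1)) (hd1 _) (hd2 _)
    filter_upwards [hev] with t ht
    have := h (t • EuclideanSpace.single i 1) (by simpa [norm_smul] using ht)
    rw [hb] at this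
    simp only [norm_smul, PiLp.norm_single, norm_one, mul_one, Real.norm_eq_abs, sq_abs] at this
    simp only [zero_smul, add_zero]
    linarith
  · intro h
    rw [hsum, ← Finset.sum_neg_distrib]
    apply Finset.sum_le_sum
    intro i _
    apply neg_le.1
    apply second_test (g := fun t => - u (x + t • EuclideanSpace.single i 1))
      (b := - b (EuclideanSpace.single i 1)) (fun t => (hd1 _ t).neg) (hd2 _).neg
    filter_upwards [hev] with t ht
    have := h (t • EuclideanSpace.single i 1) (by simpa [norm_smul] using ht)
    rw [hb] at this
    simp only [norm_smul, PiLp.norm_single, norm_one, mul_one, Real.norm_eq_abs, sq_abs] at this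
    simp only [zero_smul, add_zero]
    linarith

theorem frac_translate {s : ℝ} {u : EuclideanSpace ℝ (Fin n) → ℝ} {x : EuclideanSpace ℝ (Fin n)} {L : ℝ}
    (h : IsFracLapAt n s u x L) :
    Tendsto (fun ε : ℝ => ∫ z in Sset n ε, (u x - u (x + z)) / ‖z‖ ^ ((n:ℝ) + 2 * s)) (𝓝[>] 0) (𝓝 L) := by
  refine Tendsto.congr (fun ε => ?_) h
  have hm : MeasurableSet {y : EuclideanSpace ℝ (Fin n) | ε ≤ dist x y} :=
    (isClosed_le continuous_const (continuous_const.dist continuous_id)).measurableSet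
  rw [← integral_indicator hm, ← integral_indicator (Sset_meas ε),
    ← integral_add_left_eq_self _ x]
  congr 1
  ext z
  by_cases hz : ε ≤ ‖z‖ <;> simp [indicator, Sset, hz]

open scoped Pointwise in
theorem I_scaled {a K A ε : ℝ} (hA : 1 ≤ A) (hε : 0 < ε) (hε1 : ε < 1)
    (hK : ∀ ε, 0 < ε → ε < 1 → ∀ x : EuclideanSpace ℝ (Fin n),
      -(K * vfun a x) ≤ ∫ z in Sset n ε, (vfun a x - vfun a (x+z)) / ‖z‖^(2*a))
    (x : EuclideanSpace ℝ (Fin n)) :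
    -(K * A^((n:ℝ) - 2*a) * vfun a (A⁻¹ • x)) ≤
      ∫ z in Sset n ε, (vfun a (A⁻¹ • x) - vfun a (A⁻¹ • (x+z))) / ‖z‖^(2*a) := by
  have hA0 : 0 < A := by linarith
  set f : EuclideanSpace ℝ (Fin n) → ℝ :=
    fun z => (vfun a (A⁻¹ • x) - vfun a (A⁻¹ • x + z)) / ‖z‖^(2*a) with hf
  have h1 := Measure.setIntegral_comp_smul_of_pos volume f (Sset n ε) (inv_pos.2 hA0)
  have hset : A⁻¹ • Sset n ε = Sset n (ε / A) := by
    ext z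
    rw [mem_smul_set_iff_inv_smul_mem₀ (inv_pos.2 hA0).ne']
    simp only [Sset, mem_ofPred_eq, inv_inv, norm_smul, Real.norm_of_nonneg hA0.le]
    rw [div_le_iff₀ hA0, mul_comm]
  have h2 := hK (ε / A) (by positivity) ((div_le_self hε.le hA).trans_lt hε1) (A⁻¹ • x)
  rw [hset] at h1
  have h3 : ∀ z, (vfun a (A⁻¹ • x) - vfun a (A⁻¹ • (x+z))) / ‖z‖^(2*a) = (A^(2*a))⁻¹ * f (A⁻¹ • z) := by
    intro z
    simp only [hf, smul_add, norm_smul, norm_inv, Real.norm_of_nonneg hA0.le]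
    rw [Real.mul_rpow (by positivity) (by positivity), Real.inv_rpow hA0.le]
    have : 0 < A^(2*a) := by positivity
    field_simp
  simp only [h3]
  rw [integral_const_mul, h1, Real.rpow_sub hA0, Real.rpow_natCast]
  simp only [finrank_euclideanSpace, Fintype.card_fin, smul_eq_mul, inv_pow, inv_inv]
  have h4 : 0 ≤ (A^(2*a))⁻¹ * A^n := by positivity
  have := mul_le_mul_of_nonneg_left h2 h4
  refine le_trans (le_of_eq ?_) (this.trans (le_of_eq ?_))
  · field_simp
  · ring

theorem lfun_hom (a : ℝ) (x z : EuclideanSpace ℝ (Fin n)) (t : ℝ) : lfun a x (t • z) = t * lfun a x z := by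
  simp only [lfun, inner_smul_right]; ring

theorem u_bdd {u : EuclideanSpace ℝ (Fin n) → ℝ} (hc : Continuous u)
    (hpos : ∀ x, 0 < u x)
    (hdecay : Tendsto u (cocompact (EuclideanSpace ℝ (Fin n))) (𝓝 0)) :
    ∃ B, 0 < B ∧ ∀ x, u x ≤ B := by
  have h : ∀ᶠ x in cocompact (EuclideanSpace ℝ (Fin n)), u x ≤ u 0 := by
    filter_upwards [hdecay.eventually (gt_mem_nhds (hpos 0))] with x hx using hx.le
  obtain ⟨y, hy⟩ := hc.exists_forall_ge' 0 h
  exact ⟨u y, hpos y, hy⟩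

theorem ev_norm {P : EuclideanSpace ℝ (Fin n) → Prop}
    (h : ∀ᶠ x in cocompact (EuclideanSpace ℝ (Fin n)), P x) : ∃ R : ℝ, 1 ≤ R ∧ ∀ x, R ≤ ‖x‖ → P x := by
  rw [← Metric.cobounded_eq_cocompact, ← comap_norm_atTop] at h
  obtain ⟨t, ht, hP⟩ := mem_comap.1 h
  obtain ⟨R, hR⟩ := mem_atTop_sets.1 ht
  exact ⟨max R 1, le_max_right _ _, fun x hx => hP (hR _ ((le_max_left _ _).trans hx))⟩

theorem v_tendsto {a : ℝ} (ha : 1 < a) :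
    Tendsto (vfun (n := n) a) (cocompact (EuclideanSpace ℝ (Fin n))) (𝓝 0) := by
  have h1 : Tendsto (fun x : EuclideanSpace ℝ (Fin n) => 1 + ‖x‖^2) (cocompact _) atTop :=
    tendsto_atTop_add_const_left _ _ ((tendsto_pow_atTop two_ne_zero).comp (tendsto_norm_cocompact_atTop))
  exact (tendsto_rpow_neg_atTop (by linarith : 0 < a)).comp h1

theorem upper {s p cns : ℝ} (hn : 2 ≤ n)
    (hs : s ∈ Set.Ioo (0 : ℝ) 1) (hp : 1 < p) (hcns : 0 < cns)
    {u : EuclideanSpace ℝ (Fin n) → ℝ} (hu2 : ContDiff ℝ 2 u)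
    {Lu : EuclideanSpace ℝ (Fin n) → ℝ}
    (hLu : ∀ x : EuclideanSpace ℝ (Fin n), IsFracLapAt n s u x (Lu x))
    (heq : ∀ x : EuclideanSpace ℝ (Fin n), -(lapl n u x) + cns * Lu x + u x = u x ^ p)
    (hupos : ∀ x : EuclideanSpace ℝ (Fin n), 0 < u x)
    (hdecay : Tendsto u (cocompact (EuclideanSpace ℝ (Fin n))) (𝓝 0)) :
    ∃ C₂ : ℝ, 0 < C₂ ∧ ∀ x, 1 ≤ ‖x‖ → u x ≤ C₂ / ‖x‖ ^ ((n : ℝ) + 2 * s) := by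
  obtain ⟨hs0, hs1⟩ := hs
  have hn' : (2:ℝ) ≤ n := by exact_mod_cast hn
  obtain ⟨a, haa⟩ : ∃ a : ℝ, 2 * a = (n:ℝ) + 2 * s := ⟨(n:ℝ)/2 + s, by ring⟩
  have ha1 : 1 < a := by linarith
  obtain ⟨K, hK0, hK⟩ := I_bounds (a := a) hn ha1 (by linarith) (by linarith)
  obtain ⟨C, hC1, hC⟩ := vtaylor (n := n) ha1
  have hcu := hu2.continuous
  obtain ⟨A, hA1, hA⟩ : ∃ A : ℝ, 1 ≤ A ∧
      n * (2 * (C * A^(-2:ℝ))) + cns * (K * A^((n:ℝ) - 2*a)) ≤ 1/4 := by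
    have t1 : Tendsto (fun A : ℝ => n * (2 * (C * A^(-2:ℝ))) + cns * (K * A^((n:ℝ) - 2*a))) atTop (𝓝 0) := by
      have e1 := ((tendsto_rpow_neg_atTop (by norm_num : (0:ℝ) < 2)).const_mul C).const_mul 2 |>.const_mul (n:ℝ)
      have e2 := ((tendsto_rpow_neg_atTop (by linarith : (0:ℝ) < 2*a - n)).const_mul K).const_mul cns
      have := e1.add e2
      simpa using this
    obtain ⟨A, h1, h2⟩ := ((eventually_ge_atTop (1:ℝ)).and (t1.eventually (gt_mem_nhds (by norm_num : (0:ℝ) < 1/4)))).exists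
    exact ⟨A, h1, h2.le⟩
  have hA0 : 0 < A := by linarith
  obtain ⟨R, hR1, hR⟩ : ∃ R : ℝ, 1 ≤ R ∧ ∀ x, R ≤ ‖x‖ → u x ^ p ≤ u x / 2 := by
    apply ev_norm
    have t := hdecay.rpow_const (p := p - 1) (Or.inr (by linarith))
    rw [Real.zero_rpow (by linarith)] at t
    filter_upwards [t.eventually (gt_mem_nhds (by norm_num : (0:ℝ) < 1/2))] with x hx
    have e : u x ^ p = u x ^ (p-1) * u x := by
      rw [Real.rpow_sub (hupos x), Real.rpow_one, div_mul_cancel₀ _ (hupos x).ne']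
    rw [e]
    nlinarith [hupos x]
  obtain ⟨B, hB0, hB⟩ := u_bdd hcu hupos hdecay
  set q : ℝ := (1 + R^2)^(-a) with hq
  have hq0 : 0 < q := by positivity
  have hvq : ∀ x : EuclideanSpace ℝ (Fin n), ‖x‖ ≤ R → q ≤ vfun a (A⁻¹ • x) := by
    intro x hx
    unfold vfun
    apply Real.rpow_le_rpow_of_nonpos (by positivity) _ (by linarith)
    have : ‖A⁻¹ • x‖ ≤ R := by
      rw [norm_smul, norm_inv, Real.norm_of_nonneg hA0.le]
      have := inv_le_one_of_one_le₀ hA1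
      nlinarith [norm_nonneg x]
    nlinarith [norm_nonneg (A⁻¹ • x)]
  set M := B / q with hM
  have hM0 : 0 < M := by positivity
  have hMq : M * q = B := by rw [hM]; field_simp
  have key : ∀ x, u x ≤ M * vfun a (A⁻¹ • x) := by
    by_contra hcon
    push Not at hcon
    obtain ⟨x1, hx1⟩ := hcon
    have hw : Continuous fun x => M * vfun a (A⁻¹ • x) - u x :=
      (continuous_const.mul ((vfun_cont a).comp (continuous_const_smul _))).sub hcu
    obtain ⟨x0, hx0⟩ := hw.exists_forall_le' x1 (by
      filter_upwards [hdecay.eventually (gt_mem_nhds (by linarith : 0 < u x1 - M * vfun a (A⁻¹ • x1)))] with x hx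
      have := mul_pos hM0 (vfun_pos a (A⁻¹ • x))
      linarith)
    set V := vfun a (A⁻¹ • x0) with hV
    have hVpos : 0 < V := vfun_pos _ _
    have hneg : M * V < u x0 := by have := hx0 x1; linarith
    have hxR : R ≤ ‖x0‖ := by
      by_contra h
      push Not at h
      have h1 := hvq x0 h.le
      have := mul_le_mul_of_nonneg_left h1 hM0.le
      linarith [hB x0]
    have hL : -(M * (K * A^((n:ℝ) - 2*a) * V)) ≤ Lu x0 := by
      refine ge_of_tendsto (frac_translate (hLu x0)) ?_
      filter_upwards [Ioo_mem_nhdsGT (zero_lt_one)] with ε hε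
      have hs := I_scaled hA1 hε.1 hε.2 (fun ε h1 h2 x => (hK ε h1 h2 x).1) x0
      have hcv : Continuous fun z => M * (vfun a (A⁻¹ • x0) - vfun a (A⁻¹ • (x0 + z))) :=
        continuous_const.mul (continuous_const.sub ((vfun_cont a).comp (by fun_prop)))
      have hi1 := bdd_int (m := 2 * a) (by linarith) hε.1 Subset.rfl (Sset_meas ε) hcv (B := M) (fun z _ => by
        rw [abs_mul, abs_of_pos hM0]
        have := vdiff_bound ha1 (A⁻¹ • x0) (A⁻¹ • (x0 + z))
        nlinarith)
      have hcu' : Continuous fun z => u x0 - u (x0 + z) := continuous_const.sub (hcu.comp (by fun_prop))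
      have hi2 := bdd_int (m := 2 * a) (by linarith) hε.1 Subset.rfl (Sset_meas ε) hcu' (B := B) (fun z _ => by
        rw [abs_le]; constructor <;> linarith [hB x0, hB (x0+z), hupos x0, hupos (x0+z)])
      rw [← haa]
      calc _ ≤ M * ∫ z in Sset n ε, (vfun a (A⁻¹ • x0) - vfun a (A⁻¹ • (x0+z))) / ‖z‖^(2*a) := by
            have := mul_le_mul_of_nonneg_left hs hM0.le
            linarith
        _ = ∫ z in Sset n ε, M * (vfun a (A⁻¹ • x0) - vfun a (A⁻¹ • (x0+z))) / ‖z‖^(2*a) := by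
            rw [← integral_const_mul]; simp only [mul_div_assoc]
        _ ≤ _ := by
            apply setIntegral_mono_on hi1 hi2 (Sset_meas ε)
            intro z _
            apply div_le_div_of_nonneg_right _ (by positivity)
            linarith [hx0 (x0 + z)]
    have hlap : lapl n u x0 ≤ n * (2 * (M * V * (C * A^(-2:ℝ)))) := by
      apply (lapl_touch hu2 x0 (M * V * (C * A^(-2:ℝ))) 1 one_pos
        (fun z => - (M * V * lfun a (A⁻¹ • x0) (A⁻¹ • z))) ?_).1
      · intro z hz
        have hnz : ‖A⁻¹ • z‖ = A⁻¹ * ‖z‖ := by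
          rw [norm_smul, norm_inv, Real.norm_of_nonneg hA0.le]
        have h1 := (hC (A⁻¹ • x0) (A⁻¹ • z) (by
          rw [hnz]
          have := inv_le_one_of_one_le₀ hA1
          nlinarith [norm_nonneg z, inv_pos.2 hA0])).1
        have h2 := hx0 (x0 + z)
        rw [smul_add] at h2
        have h3 := mul_le_mul_of_nonneg_left h1 hM0.le
        rw [hnz, mul_pow, inv_pow] at h3
        rw [Real.rpow_neg hA0.le, Real.rpow_two]
        change _ ≤ M * (V * _) at h3
        linarith
      · intro t z
        rw [smul_comm, lfun_hom]; ring
    have h1 := heq x0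
    have h2 := hR x0 hxR
    have h3 := mul_le_mul_of_nonneg_left hL hcns.le
    have h4 := mul_le_mul_of_nonneg_left hA (mul_pos hM0 hVpos).le
    nlinarith
  refine ⟨M * A^(2*a), by positivity, fun x hx => ?_⟩
  refine (key x).trans ?_
  rw [← haa, mul_div_assoc]
  apply mul_le_mul_of_nonneg_left _ hM0.le
  have hx0 : 0 < ‖x‖ := by linarith
  rw [← Real.div_rpow hA0.le hx0.le, ← inv_div, Real.inv_rpow (by positivity), Real.rpow_mul (by positivity),
    ← Real.rpow_neg (by positivity), vfun]
  apply Real.rpow_le_rpow_of_nonpos (by positivity) _ (by linarith)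
  rw [norm_smul, norm_inv, Real.norm_of_nonneg hA0.le, Real.rpow_two, div_eq_inv_mul]
  linarith

theorem lower {s p cns : ℝ} (hn : 2 ≤ n)
    (hs : s ∈ Set.Ioo (0 : ℝ) 1) (hcns : 0 < cns)
    {u : EuclideanSpace ℝ (Fin n) → ℝ} (hu2 : ContDiff ℝ 2 u)
    {Lu : EuclideanSpace ℝ (Fin n) → ℝ}
    (hLu : ∀ x : EuclideanSpace ℝ (Fin n), IsFracLapAt n s u x (Lu x))
    (heq : ∀ x : EuclideanSpace ℝ (Fin n), -(lapl n u x) + cns * Lu x + u x = u x ^ p)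
    (hupos : ∀ x : EuclideanSpace ℝ (Fin n), 0 < u x)
    (hdecay : Tendsto u (cocompact (EuclideanSpace ℝ (Fin n))) (𝓝 0)) :
    ∃ C₁ : ℝ, 0 < C₁ ∧ ∀ x, 1 ≤ ‖x‖ → C₁ / ‖x‖ ^ ((n : ℝ) + 2 * s) ≤ u x := by
  obtain ⟨hs0, hs1⟩ := hs
  have hn' : (2:ℝ) ≤ n := by exact_mod_cast hn
  obtain ⟨a, haa⟩ : ∃ a : ℝ, 2 * a = (n:ℝ) + 2 * s := ⟨(n:ℝ)/2 + s, by ring⟩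
  have ha1 : 1 < a := by linarith
  obtain ⟨K, hK0, hK⟩ := I_bounds (a := a) hn ha1 (by linarith) (by linarith)
  obtain ⟨C, hC1, hC⟩ := vtaylor (n := n) ha1
  have hcu := hu2.continuous
  obtain ⟨B, hB0, hB⟩ := u_bdd hcu hupos hdecay
  set ω : ℝ := volume.real (Metric.ball (0 : EuclideanSpace ℝ (Fin n)) 1) with hω
  have hω0 : 0 < ω := by
    rw [hω, measureReal_def]
    exact ENNReal.toReal_pos (Metric.measure_ball_pos _ _ one_pos).ne' measure_ball_lt_top.ne
  set c4 : ℝ := (4:ℝ)^(-a) with hc4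
  have hc40 : 0 < c4 := by positivity
  set M : ℝ := (n * (2 * C) + cns * K + 1) / (cns * c4 * ω) with hM
  have hM0 : 0 < M := by positivity
  have hMeq : cns * (M * c4 * ω) = n * (2 * C) + cns * K + 1 := by
    rw [hM]; field_simp
  obtain ⟨y0, -, hy0⟩ := (isCompact_closedBall (0 : EuclideanSpace ℝ (Fin n)) 2).exists_isMinOn
    ⟨0, by simp⟩ hcu.continuousOn
  set δ := u y0 / (M + 1) with hδ
  have hδ0 : 0 < δ := div_pos (hupos _) (by linarith)
  have hδu : ∀ x : EuclideanSpace ℝ (Fin n), ‖x‖ ≤ 2 → δ * (M + 1) ≤ u x := by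
    intro x hx
    have e : δ * (M+1) = u y0 := by rw [hδ]; field_simp
    rw [e]
    exact hy0 (by simpa using hx)
  have key : ∀ x, δ * vfun a x ≤ u x := by
    by_contra hcon
    push Not at hcon
    obtain ⟨x1, hx1⟩ := hcon
    have hw : Continuous fun x => u x - δ * vfun a x :=
      hcu.sub (continuous_const.mul (vfun_cont a))
    obtain ⟨x0, hx0⟩ := hw.exists_forall_le' x1 (by
      have t := ((v_tendsto (n := n) ha1).const_mul δ)
      rw [mul_zero] at t
      filter_upwards [t.eventually (gt_mem_nhds (by linarith : 0 < δ * vfun a x1 - u x1))] with x hx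
      linarith [hupos x])
    set V := vfun a x0 with hV
    have hVpos : 0 < V := vfun_pos _ _
    have hneg : u x0 < δ * V := by have := hx0 x1; linarith
    have hxR : 2 ≤ ‖x0‖ := by
      by_contra h
      push Not at h
      have h1 := hδu x0 h.le
      have := mul_le_mul_of_nonneg_left (vfun_le_one ha1 x0) hδ0.le
      nlinarith [mul_pos hδ0 hM0]
    have hL : Lu x0 ≤ δ * (K * V) - ω * (δ * M * c4 * V) := by
      refine le_of_tendsto (frac_translate (hLu x0)) ?_
      filter_upwards [Ioo_mem_nhdsGT (zero_lt_one)] with ε hε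
      have hs := (hK ε hε.1 hε.2 x0).2
      have hcv : Continuous fun z => δ * (vfun a x0 - vfun a (x0 + z)) :=
        continuous_const.mul (continuous_const.sub ((vfun_cont a).comp (by fun_prop)))
      have hi1 := bdd_int (m := 2 * a) (by linarith) hε.1 Subset.rfl (Sset_meas ε) hcv (B := δ) (fun z _ => by
        rw [abs_mul, abs_of_pos hδ0]
        have := vdiff_bound ha1 x0 (x0 + z)
        nlinarith)
      have hcu' : Continuous fun z => u x0 - u (x0 + z) := continuous_const.sub (hcu.comp (by fun_prop))
      have hi2 := bdd_int (m := 2 * a) (by linarith) hε.1 Subset.rfl (Sset_meas ε) hcu' (B := B) (fun z _ => by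
        rw [abs_le]; constructor <;> linarith [hB x0, hB (x0+z), hupos x0, hupos (x0+z)])
      set T := Metric.ball (-x0) 1 with hT
      have hTm : MeasurableSet T := measurableSet_ball
      have hTS : T ⊆ Sset n ε := by
        intro z hz
        have h1 : ‖z + x0‖ < 1 := by simpa [hT, dist_eq_norm] using hz
        have h2 : ‖x0‖ ≤ ‖z + x0‖ + ‖z‖ := by
          have := norm_sub_le (z + x0) z
          simpa using this
        change ε ≤ ‖z‖
        linarith [hε.2]
      have hi3 : IntegrableOn (T.indicator fun _ => δ * M * c4 * V) (Sset n ε) := by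
        apply Integrable.integrableOn
        rw [integrable_indicator_iff hTm]
        exact integrableOn_const measure_ball_lt_top.ne
      have e3 : ∫ z in Sset n ε, T.indicator (fun _ => δ * M * c4 * V) z = ω * (δ * M * c4 * V) := by
        rw [setIntegral_indicator hTm, inter_eq_self_of_subset_right hTS, setIntegral_const, smul_eq_mul, hω]
        congr 1
        rw [measureReal_def, measureReal_def, hT, Measure.addHaar_ball_center]
      rw [← haa]
      calc _ ≤ ∫ z in Sset n ε, (δ * (vfun a x0 - vfun a (x0+z)) / ‖z‖^(2*a)
                - T.indicator (fun _ => δ * M * c4 * V) z) := by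
            apply setIntegral_mono_on hi2 (hi1.sub hi3) (Sset_meas ε)
            intro z hz
            simp only [Pi.sub_apply]
            by_cases hzT : z ∈ T
            · rw [indicator_of_mem hzT]
              have h1 : ‖z + x0‖ < 1 := by simpa [hT, dist_eq_norm] using hzT
              rw [add_comm] at h1
              have hz0 : 0 < ‖z‖ := hε.1.trans_le (hTS hzT)
              have hz2 : ‖z‖ ≤ 2 * ‖x0‖ := by
                have := norm_sub_le (x0 + z) x0
                simp at this
                linarith
              have hu1 := hδu (x0 + z) (by linarith)
              have hv1 := mul_le_mul_of_nonneg_left (vfun_le_one ha1 (x0+z)) hδ0.le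
              have hker : c4 * V ≤ (‖z‖^(2*a))⁻¹ := by
                rw [hc4, hV, vfun, ← Real.mul_rpow (by norm_num) (by positivity),
                  Real.rpow_mul hz0.le, ← Real.rpow_neg (by positivity)]
                apply Real.rpow_le_rpow_of_nonpos (by positivity) _ (by linarith)
                rw [Real.rpow_two]
                nlinarith
              have hk2 := mul_le_mul_of_nonneg_left hker (mul_pos hδ0 hM0).le
              rw [div_eq_mul_inv, div_eq_mul_inv]
              have hnum : u x0 - u (x0 + z) ≤ δ * (vfun a x0 - vfun a (x0+z)) - δ * M := by
                change _ ≤ δ * (V - _) - _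
                linarith
              have := mul_le_mul_of_nonneg_right hnum (by positivity : 0 ≤ (‖z‖^(2*a))⁻¹)
              linarith
            · rw [indicator_of_notMem hzT, sub_zero]
              apply div_le_div_of_nonneg_right _ (by positivity)
              linarith [hx0 (x0 + z)]
        _ = δ * (∫ z in Sset n ε, (vfun a x0 - vfun a (x0+z)) / ‖z‖^(2*a)) - ω * (δ * M * c4 * V) := by
            rw [integral_sub hi1 hi3, e3, ← integral_const_mul]; simp only [mul_div_assoc]
        _ ≤ _ := by
            have := mul_le_mul_of_nonneg_left hs hδ0.le
            linarith
    have hlap : -(n * (2 * (δ * V * C))) ≤ lapl n u x0 := by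
      apply (lapl_touch hu2 x0 (δ * V * C) 1 one_pos (fun z => - (δ * V * lfun a x0 z)) ?_).2
      · intro z hz
        have h1 := (hC x0 z hz).2
        have h2 := hx0 (x0 + z)
        have h3 := mul_le_mul_of_nonneg_left h1 hδ0.le
        change δ * (V * _) ≤ _ at h3
        linarith
      · intro t z
        rw [lfun_hom]; ring
    have h1 := heq x0
    have h2 : 0 < u x0 ^ p := Real.rpow_pos_of_pos (hupos x0) p
    have h3 := mul_le_mul_of_nonneg_left hL hcns.le
    have h4 : δ * V * (cns * (M * c4 * ω)) = δ * V * (n * (2 * C) + cns * K + 1) := by rw [hMeq]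
    linarith
  refine ⟨δ * 2^(-a), by positivity, fun x hx => le_trans ?_ (key x)⟩
  have hx0 : 0 < ‖x‖ := by linarith
  rw [← haa, mul_div_assoc]
  apply mul_le_mul_of_nonneg_left _ hδ0.le
  rw [Real.rpow_mul hx0.le, div_eq_mul_inv, ← Real.rpow_neg (by positivity),
    ← Real.mul_rpow (by positivity) (by positivity), vfun]
  apply Real.rpow_le_rpow_of_nonpos (by positivity) _ (by linarith)
  rw [Real.rpow_two]
  nlinarith

end Aux

/-- A positive classical solution of `−Δu + (−Δ)ˢu + u = uᵖ` in `ℝⁿ`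
vanishing at infinity decays exactly like `|x|^{−n−2s}`: there are `0 < C₁ ≤ C₂` with
`C₁/|x|^{n+2s} ≤ u(x) ≤ C₂/|x|^{n+2s}` for all `|x| ≥ 1`. -/
theorem power_type_decay (n : ℕ) (hn : 2 ≤ n) (s p cns : ℝ)
    (hs : s ∈ Set.Ioo (0 : ℝ) 1) (hp : 1 < p)
    (hpc : n = 2 ∨ p < ((n : ℝ) + 2) / ((n : ℝ) - 2)) (hcns : 0 < cns)
    (u : EuclideanSpace ℝ (Fin n) → ℝ) (hu2 : ContDiff ℝ 2 u)
    (Lu : EuclideanSpace ℝ (Fin n) → ℝ)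
    (hLu : ∀ x : EuclideanSpace ℝ (Fin n), IsFracLapAt n s u x (Lu x))
    (heq : ∀ x : EuclideanSpace ℝ (Fin n), -(lapl n u x) + cns * Lu x + u x = u x ^ p)
    (hupos : ∀ x : EuclideanSpace ℝ (Fin n), 0 < u x)
    (hdecay : Filter.Tendsto u (Filter.cocompact (EuclideanSpace ℝ (Fin n))) (nhds 0)) :
    ∃ C₁ C₂ : ℝ, 0 < C₁ ∧ C₁ ≤ C₂ ∧
      ∀ x : EuclideanSpace ℝ (Fin n), 1 ≤ ‖x‖ →
        C₁ / ‖x‖ ^ ((n : ℝ) + 2 * s) ≤ u x ∧ u x ≤ C₂ / ‖x‖ ^ ((n : ℝ) + 2 * s) := by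
  obtain ⟨C₂, h2, hU⟩ := upper hn hs hp hcns hu2 hLu heq hupos hdecay
  obtain ⟨C₁, h1, hL⟩ := lower hn hs hcns hu2 hLu heq hupos hdecay
  refine ⟨C₁, max C₁ C₂, h1, le_max_left _ _, fun x hx => ⟨hL x hx, (hU x hx).trans ?_⟩⟩
  exact div_le_div_of_nonneg_right (le_max_right _ _) (by positivity)
end
end

section
/- Lemma (moving plane step): let u ∈ C²(ℝⁿ) solve −Δu + (−Δ)^s u + u = u^p in ℝⁿ with u > 0, and fix λ ∈ ℝ. If u ≥ u_λ in the half-space Σ_λ = {x₁ > λ} and u ≢ u_λ in Σ_λ, then u > u_λ strictly in Σ_λ. -/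
open MeasureTheory Filter Set
open scoped Topology

noncomputable section

/-- Reflection across the hyperplane `{x₁ = λ}`: `x ↦ (2λ − x₁, x₂, …, xₙ)`. -/
def reflHyp (n : ℕ) [NeZero n] (lam : ℝ) (x : EuclideanSpace ℝ (Fin n)) :
    EuclideanSpace ℝ (Fin n) :=
  x + (2 * lam - 2 * x 0) • EuclideanSpace.single (0 : Fin n) (1 : ℝ)

/-! ### Reflection -/


theorem mp_refl_eq (n : ℕ) [NeZero n] (lam : ℝ) (x : EuclideanSpace ℝ (Fin n)) :
    reflHyp n lam x = (Submodule.reflection (Submodule.span ℝ {(EuclideanSpace.single (0 : Fin n) (1 : ℝ))})ᗮ) x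
      + (2 * lam) • EuclideanSpace.single (0 : Fin n) (1 : ℝ) := by
  rw [Submodule.reflection_orthogonal_apply, Submodule.reflection_singleton_apply]
  simp only [reflHyp, EuclideanSpace.inner_single_left, EuclideanSpace.norm_single]
  ext i
  simp
  split_ifs <;> ring

theorem mp_refl_zero (n : ℕ) [NeZero n] (lam : ℝ) (x : EuclideanSpace ℝ (Fin n)) :
    (reflHyp n lam x) 0 = 2 * lam - x 0 := by
  simp [reflHyp]; ring

theorem mp_refl_invol (n : ℕ) [NeZero n] (lam : ℝ) (x : EuclideanSpace ℝ (Fin n)) :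
    reflHyp n lam (reflHyp n lam x) = x := by
  conv_lhs => rw [reflHyp]
  rw [mp_refl_zero, reflHyp, add_assoc, ← add_smul]
  have : 2 * lam - 2 * x 0 + (2 * lam - 2 * (2 * lam - x 0)) = 0 := by ring
  rw [this]; simp

theorem mp_refl_dist (n : ℕ) [NeZero n] (lam : ℝ) (x y : EuclideanSpace ℝ (Fin n)) :
    dist (reflHyp n lam x) (reflHyp n lam y) = dist x y := by
  rw [mp_refl_eq, mp_refl_eq, dist_add_right, LinearIsometryEquiv.dist_map]

theorem mp_refl_dist' (n : ℕ) [NeZero n] (lam : ℝ) (x y : EuclideanSpace ℝ (Fin n)) :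
    dist (reflHyp n lam x) y = dist x (reflHyp n lam y) := by
  rw [← mp_refl_dist n lam x, mp_refl_invol]

theorem mp_refl_mp (n : ℕ) [NeZero n] (lam : ℝ) :
    MeasurePreserving (reflHyp n lam) (volume : Measure (EuclideanSpace ℝ (Fin n))) volume := by
  have h : reflHyp n lam = (fun x : EuclideanSpace ℝ (Fin n) => x + (2 * lam) • EuclideanSpace.single (0 : Fin n) (1 : ℝ)) ∘
      (Submodule.reflection (Submodule.span ℝ {(EuclideanSpace.single (0 : Fin n) (1 : ℝ))})ᗮ) := by
    funext x; exact mp_refl_eq n lam x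
  rw [h]
  exact (measurePreserving_add_right volume _).comp (LinearIsometryEquiv.measurePreserving _)

theorem mp_refl_cont (n : ℕ) [NeZero n] (lam : ℝ) : Continuous (reflHyp n lam) :=
  (Isometry.of_dist_eq (mp_refl_dist n lam)).continuous

theorem mp_refl_emb (n : ℕ) [NeZero n] (lam : ℝ) : MeasurableEmbedding (reflHyp n lam) :=
  (mp_refl_cont n lam).measurableEmbedding
    (Isometry.of_dist_eq (mp_refl_dist n lam)).injective

theorem mp_dist_lt (n : ℕ) [NeZero n] (lam : ℝ) (x y : EuclideanSpace ℝ (Fin n)) (hx : lam < x 0) (hy : lam < y 0) :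
    dist x y < dist (reflHyp n lam x) y := by
  rw [dist_eq_norm, dist_eq_norm]
  apply lt_of_pow_lt_pow_left₀ 2 (norm_nonneg _)
  have h : reflHyp n lam x - y = (x - y) + (2 * lam - 2 * x 0) • EuclideanSpace.single (0 : Fin n) (1 : ℝ) := by
    rw [reflHyp]; abel
  rw [h, norm_add_sq_real, inner_smul_right, EuclideanSpace.inner_single_right, norm_smul,
    EuclideanSpace.norm_single]
  simp only [mul_pow, Real.norm_eq_abs, sq_abs]
  simp
  nlinarith [mul_pos (sub_pos.2 hx) (sub_pos.2 hy)]

/-! ### Second derivative test -/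

theorem mp_deriv2_nonneg (g : ℝ → ℝ) (x₀ : ℝ) (hmin : IsLocalMin g x₀) (hc : ContinuousAt g x₀) :
    0 ≤ deriv (deriv g) x₀ := by
  by_contra hneg
  push Not at hneg
  have hmax := isLocalMax_of_deriv_deriv_neg hneg hmin.deriv_eq_zero hc
  have heq : g =ᶠ[𝓝 x₀] fun _ => g x₀ := by
    filter_upwards [hmin, hmax] with t h1 h2
    exact le_antisymm h2 h1
  have h2 : deriv g =ᶠ[𝓝 x₀] deriv (fun _ => g x₀) := heq.deriv
  have h3 := h2.deriv_eq
  simp at h3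
  linarith

theorem mp_line_deriv (n : ℕ) (u : (EuclideanSpace ℝ (Fin n)) → ℝ) (hu : Differentiable ℝ u) (x v : EuclideanSpace ℝ (Fin n)) (t : ℝ) :
    HasDerivAt (fun t : ℝ => u (x + t • v)) (fderiv ℝ u (x + t • v) v) t := by
  have h1 : HasDerivAt (fun t : ℝ => x + t • v) v t := by
    simpa using ((hasDerivAt_id t).smul_const v).const_add x
  exact (hu (x + t • v)).hasFDerivAt.comp_hasDerivAt t h1

theorem mp_c1 (n : ℕ) (u : (EuclideanSpace ℝ (Fin n)) → ℝ) (hu : ContDiff ℝ 2 u) (v : EuclideanSpace ℝ (Fin n)) :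
    ContDiff ℝ 1 (fun y => fderiv ℝ u y v) := by
  have := hu.fderiv_right (m := 1) (by norm_num)
  exact this.clm_apply contDiff_const

theorem mp_line_deriv2 (n : ℕ) (u : (EuclideanSpace ℝ (Fin n)) → ℝ) (hu : ContDiff ℝ 2 u) (x v : EuclideanSpace ℝ (Fin n)) (c : ℝ) (t : ℝ) :
    HasDerivAt (fun t : ℝ => u (x + (c * t) • v)) (c * fderiv ℝ u (x + (c * t) • v) v) t ∧
    HasDerivAt (fun t : ℝ => c * fderiv ℝ u (x + (c * t) • v) v)
      (c ^ 2 * fderiv ℝ (fun y => fderiv ℝ u y v) (x + (c * t) • v) v) t := by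
  have hc : HasDerivAt (fun t : ℝ => c * t) c t := by simpa using (hasDerivAt_id t).const_mul c
  constructor
  · have := (mp_line_deriv n u (hu.differentiable (by norm_num)) x v (c * t)).comp t hc
    rw [mul_comm]; exact this
  · have := ((mp_line_deriv n _ ((mp_c1 n u hu v).differentiable (by norm_num)) x v (c * t)).comp t hc).const_mul c
    refine HasDerivAt.congr_deriv this ?_
    ring

theorem mp_lapl_le (n : ℕ) [NeZero n] (lam : ℝ) (u : (EuclideanSpace ℝ (Fin n)) → ℝ) (hu : ContDiff ℝ 2 u) (x : EuclideanSpace ℝ (Fin n))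
    (hx : lam < x 0) (heq : u (reflHyp n lam x) = u x)
    (hge : ∀ x : EuclideanSpace ℝ (Fin n), lam < x 0 → u (reflHyp n lam x) ≤ u x) :
    lapl n u (reflHyp n lam x) ≤ lapl n u x := by
  unfold lapl
  apply Finset.sum_le_sum
  intro i _
  set e : EuclideanSpace ℝ (Fin n) := EuclideanSpace.single i 1 with he
  set c : ℝ := if i = 0 then -1 else 1 with hc
  have hc2 : c ^ 2 = 1 := by rw [hc]; split_ifs <;> norm_num
  have hR : ∀ t : ℝ, reflHyp n lam (x + t • e) = reflHyp n lam x + (c * t) • e := by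
    intro t
    ext j
    simp only [reflHyp, he, hc]
    by_cases hi : i = 0
    · subst hi; simp
      by_cases hj : j = 0
      · subst hj; simp; ring
      · simp [hj]
    · have : (0 : Fin n) ≠ i := fun h => hi h.symm
      simp [hi, this, add_right_comm]
  set g : ℝ → ℝ := fun t => u (x + (1 * t) • e) - u (reflHyp n lam x + (c * t) • e) with hg
  have hd1 : deriv g = fun t => 1 * fderiv ℝ u (x + (1 * t) • e) e -
      c * fderiv ℝ u (reflHyp n lam x + (c * t) • e) e := by
    funext t
    exact ((mp_line_deriv2 n u hu x e 1 t).1.sub (mp_line_deriv2 n u hu _ e c t).1).deriv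
  have hd2 := ((mp_line_deriv2 n u hu x e 1 0).2.sub (mp_line_deriv2 n u hu (reflHyp n lam x) e c 0).2).deriv
  have hmin : IsLocalMin g 0 := by
    have h0 : ∀ᶠ t : ℝ in 𝓝 0, lam < (x + t • e) 0 := by
      have hcont : Continuous fun t : ℝ => (x + t • e) 0 := by
        simp only [PiLp.add_apply, PiLp.smul_apply]; fun_prop
      exact hcont.continuousAt.eventually (lt_mem_nhds (by simpa using hx))
    filter_upwards [h0] with t ht
    have := hge _ ht
    rw [hR] at this
    simp only [hg]
    simp [heq]
    linarith
  have hcont : ContinuousAt g 0 :=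
    ((mp_line_deriv2 n u hu x e 1 0).1.sub (mp_line_deriv2 n u hu _ e c 0).1).continuousAt
  have := mp_deriv2_nonneg g 0 hmin hcont
  rw [hd1] at this
  have h3 := hd2 ▸ this
  rw [hc2] at h3
  simp at h3
  linarith
/-! ### Weighted integrability -/

theorem mp_meas_far (n : ℕ) (x : EuclideanSpace ℝ (Fin n)) (ε : ℝ) :
    MeasurableSet {y : EuclideanSpace ℝ (Fin n) | ε ≤ dist x y} :=
  measurableSet_le measurable_const (by fun_prop)

theorem mp_one_add_le (a d ε N : ℝ) (ha : 0 ≤ a) (hε : 0 < ε) (hd : ε ≤ d) (hN : N ≤ a + d) :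
    1 + N ≤ ((1 + a) / ε + 1) * d := by
  have : (1 + a) ≤ (1 + a) / ε * d := by
    rw [div_mul_eq_mul_div, le_div_iff₀ hε]
    exact mul_le_mul_of_nonneg_left hd (by linarith)
  nlinarith

/-- weighted integrability gives integrability of the truncated kernel. -/
theorem mp_far_of_weight (n : ℕ) (q : ℝ) (hq : 0 < q) (u : (EuclideanSpace ℝ (Fin n)) → ℝ) (hu : Continuous u)
    (hW : Integrable (fun y : EuclideanSpace ℝ (Fin n) => u y * (1 + ‖y‖) ^ (-q))) (x : EuclideanSpace ℝ (Fin n)) (ε : ℝ) (hε : 0 < ε) :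
    IntegrableOn (fun y : EuclideanSpace ℝ (Fin n) => u y / dist x y ^ q) {y | ε ≤ dist x y} := by
  set c : ℝ := (1 + ‖x‖) / ε + 1 with hc
  have hcpos : 0 < c := by positivity
  refine Integrable.mono' ((hW.norm.const_mul (c ^ q)).integrableOn) ?_ ?_
  · apply Measurable.aestronglyMeasurable
    have := hu.measurable
    fun_prop
  · refine (ae_restrict_iff' (mp_meas_far n x ε)).2 (Eventually.of_forall fun y hy => ?_)
    have hy' : ε ≤ dist x y := hy
    have hd : 0 < dist x y := lt_of_lt_of_le hε hy'
    have hN : ‖y‖ ≤ ‖x‖ + dist x y := by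
      rw [dist_comm, dist_eq_norm]
      have := norm_add_le x (y - x)
      simpa using this
    have h1 := mp_one_add_le ‖x‖ (dist x y) ε ‖y‖ (norm_nonneg _) hε hy' hN
    have hy1 : 0 < 1 + ‖y‖ := by positivity
    have h2 : (1 + ‖y‖) ^ q ≤ c ^ q * dist x y ^ q := by
      rw [← Real.mul_rpow hcpos.le hd.le]
      exact Real.rpow_le_rpow hy1.le h1 hq.le
    have p1 : 0 < (1 + ‖y‖) ^ q := Real.rpow_pos_of_pos hy1 _
    have p2 : 0 < dist x y ^ q := Real.rpow_pos_of_pos hd _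
    rw [norm_div, norm_mul, Real.norm_of_nonneg p2.le, Real.rpow_neg hy1.le, norm_inv,
      Real.norm_of_nonneg p1.le, ← div_eq_mul_inv, mul_div_assoc', div_le_div_iff₀ p2 p1]
    nlinarith [norm_nonneg (u y)]

theorem mp_weight_of_far (n : ℕ) (q : ℝ) (hq : 0 < q) (u : (EuclideanSpace ℝ (Fin n)) → ℝ) (hu : Continuous u)
    (x : EuclideanSpace ℝ (Fin n)) (ε : ℝ) (hε : 0 < ε)
    (hI : IntegrableOn (fun y : EuclideanSpace ℝ (Fin n) => u y / dist x y ^ q) {y | ε ≤ dist x y}) :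
    Integrable (fun y : EuclideanSpace ℝ (Fin n) => u y * (1 + ‖y‖) ^ (-q)) := by
  have hcont : Continuous (fun y : EuclideanSpace ℝ (Fin n) => u y * (1 + ‖y‖) ^ (-q)) := by
    refine hu.mul (Continuous.rpow_const (by fun_prop) fun y => Or.inl ?_)
    positivity
  rw [← integrableOn_univ, ← union_compl_self {y : EuclideanSpace ℝ (Fin n) | ε ≤ dist x y}]
  refine IntegrableOn.union ?_ ?_
  · refine Integrable.mono' (hI.norm.const_mul ((1 + ‖x‖) ^ q)) hcont.aestronglyMeasurable ?_
    refine (ae_restrict_iff' (mp_meas_far n x ε)).2 (Eventually.of_forall fun y hy => ?_)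
    have hy' : ε ≤ dist x y := hy
    have hd : 0 < dist x y := lt_of_lt_of_le hε hy'
    have hy1 : 0 < 1 + ‖y‖ := by positivity
    have hx1 : 0 < 1 + ‖x‖ := by positivity
    have hN : dist x y ≤ (1 + ‖x‖) * (1 + ‖y‖) := by
      rw [dist_eq_norm]
      nlinarith [norm_sub_le x y, norm_nonneg x, norm_nonneg y, mul_nonneg (norm_nonneg x) (norm_nonneg y)]
    have h2 : dist x y ^ q ≤ (1 + ‖x‖) ^ q * (1 + ‖y‖) ^ q := by
      rw [← Real.mul_rpow hx1.le hy1.le]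
      exact Real.rpow_le_rpow hd.le hN hq.le
    have p1 : 0 < (1 + ‖y‖) ^ q := Real.rpow_pos_of_pos hy1 _
    have p2 : 0 < dist x y ^ q := Real.rpow_pos_of_pos hd _
    rw [norm_div, norm_mul, Real.norm_of_nonneg p2.le, Real.rpow_neg hy1.le, norm_inv,
      Real.norm_of_nonneg p1.le, ← div_eq_mul_inv, mul_div_assoc', div_le_div_iff₀ p1 p2]
    nlinarith [norm_nonneg (u y)]
  · refine IntegrableOn.mono_set (hcont.continuousOn.integrableOn_compact (isCompact_closedBall x ε)) ?_
    intro y hy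
    simp only [mem_compl_iff, mem_ofPred_eq, not_le] at hy
    rw [Metric.mem_closedBall, dist_comm]
    exact hy.le

theorem mp_const_weight (n : ℕ) (q : ℝ) (hq : (n : ℝ) < q) (a : ℝ) :
    Integrable (fun y : EuclideanSpace ℝ (Fin n) => a * (1 + ‖y‖) ^ (-q)) := by
  apply Integrable.const_mul
  apply integrable_one_add_norm
  simpa using hq

theorem mp_lu_zero (n : ℕ) (s : ℝ) (hs : 0 < s) (u : (EuclideanSpace ℝ (Fin n)) → ℝ) (hu : Continuous u)
    (hW : ¬ Integrable (fun y : EuclideanSpace ℝ (Fin n) => u y * (1 + ‖y‖) ^ (-((n : ℝ) + 2 * s))))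
    (x : EuclideanSpace ℝ (Fin n)) (L : ℝ) (hL : IsFracLapAt n s u x L) : L = 0 := by
  have hq : 0 < (n : ℝ) + 2 * s := by positivity
  have hz : ∀ ε : ℝ, 0 < ε → ∫ y in {y : EuclideanSpace ℝ (Fin n) | ε ≤ dist x y},
      (u x - u y) / dist x y ^ ((n : ℝ) + 2 * s) = 0 := by
    intro ε hε
    apply integral_undef
    intro hI
    apply hW
    apply mp_weight_of_far n _ hq u hu x ε hε
    have h1 := mp_far_of_weight n _ hq (fun _ => u x) continuous_const
      (mp_const_weight n _ (by linarith) (u x)) x ε hε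
    refine (h1.sub hI).congr (Eventually.of_forall fun y => ?_)
    simp only [Pi.sub_apply]
    ring
  refine tendsto_nhds_unique hL ?_
  refine (tendsto_const_nhds (x := (0 : ℝ))).congr' ?_
  filter_upwards [self_mem_nhdsWithin] with ε hε
  exact (hz ε hε).symm
/-! ### The local equation forces weighted integrability -/

theorem mp_rho_deriv (k : ℕ) (t : ℝ) :
    HasDerivAt (fun t : ℝ => (max t 0) ^ (k + 2)) (((k : ℝ) + 2) * (max t 0) ^ (k + 1)) t := by
  rcases lt_trichotomy t 0 with h | h | h
  · rw [max_eq_right h.le]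
    have : (fun t : ℝ => (max t 0) ^ (k + 2)) =ᶠ[𝓝 t] fun _ => 0 := by
      filter_upwards [gt_mem_nhds h] with y hy
      rw [max_eq_right hy.le]; simp
    refine HasDerivAt.congr_of_eventuallyEq ?_ this
    simpa using hasDerivAt_const t (0 : ℝ)
  · subst h
    simp only [max_self]
    have h0 : ((k : ℝ) + 2) * 0 ^ (k + 1) = 0 := by simp
    rw [h0, hasDerivAt_iff_isLittleO]
    simp only [max_self, sub_zero, smul_zero]
    have h1 : (fun x : ℝ => max x 0 ^ (k + 2) - 0 ^ (k + 2)) =O[𝓝 0] fun x : ℝ => x ^ (k + 2) := by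
      refine Asymptotics.IsBigO.of_bound 1 (Eventually.of_forall fun x => ?_)
      simp only [ne_eq, Nat.add_eq_zero_iff, OfNat.ofNat_ne_zero, and_false, not_false_eq_true,
        zero_pow, sub_zero, norm_pow, Real.norm_eq_abs, one_mul]
      refine pow_le_pow_left₀ (abs_nonneg _) ?_ _
      rw [abs_of_nonneg (le_max_right _ _)]
      exact max_le (le_abs_self x) (abs_nonneg x)
    refine h1.trans_isLittleO ?_
    have := Asymptotics.isLittleO_pow_pow (𝕜 := ℝ) (m := 1) (n := k + 2) (by omega)
    simpa using this
  · have : (fun t : ℝ => (max t 0) ^ (k + 2)) =ᶠ[𝓝 t] fun t => t ^ (k + 2) := by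
      filter_upwards [lt_mem_nhds h] with y hy
      rw [max_eq_left hy.le]
    refine HasDerivAt.congr_of_eventuallyEq ?_ this
    rw [max_eq_left h.le]
    simpa using hasDerivAt_pow (k + 2) t

/-- the inner function -/
def mpF (n : ℕ) (R : ℝ) (x : EuclideanSpace ℝ (Fin n)) : ℝ := 1 - ‖x‖ ^ 2 / R ^ 2

theorem mpF_cont (n : ℕ) (R : ℝ) : Continuous (mpF n R) := by
  unfold mpF; fun_prop

theorem mpF_fderiv (n : ℕ) (R : ℝ) (x : EuclideanSpace ℝ (Fin n)) :
    HasFDerivAt (mpF n R) ((-(2 / R ^ 2)) • innerSL ℝ x) x := by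
  have h := (hasStrictFDerivAt_norm_sq x).hasFDerivAt
  have h2 := (h.mul_const (1 / R ^ 2)).const_sub 1
  have h3 : (mpF n R) = fun x : EuclideanSpace ℝ (Fin n) => 1 - ‖x‖ ^ 2 * (1 / R ^ 2) := by
    funext y; simp [mpF, div_eq_mul_inv]
  rw [h3]
  refine h2.congr_fderiv ?_
  ext v
  simp
  ring

theorem mp_rhoF_fderiv (n : ℕ) (R : ℝ) (k : ℕ) (x : EuclideanSpace ℝ (Fin n)) :
    HasFDerivAt (fun x => (max (mpF n R x) 0) ^ (k + 2))
      ((((k : ℝ) + 2) * (max (mpF n R x) 0) ^ (k + 1)) • ((-(2 / R ^ 2)) • innerSL ℝ x)) x :=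
  (mp_rho_deriv k (mpF n R x)).comp_hasFDerivAt x (mpF_fderiv n R x)

/-- first partial derivatives of the cutoff. -/
theorem mp_phi_d1 (n : ℕ) (R : ℝ) (i : Fin n) :
    (fun x : EuclideanSpace ℝ (Fin n) => fderiv ℝ (fun x => (max (mpF n R x) 0) ^ 3) x (EuclideanSpace.single i 1)) =
      fun x => (max (mpF n R x) 0) ^ 2 * (-(6 / R ^ 2) * x i) := by
  funext x
  rw [(mp_rhoF_fderiv n R 1 x).fderiv]
  simp [EuclideanSpace.inner_single_right]
  ring

theorem mp_phi_d1_has (n : ℕ) (R : ℝ) (i : Fin n) (x : EuclideanSpace ℝ (Fin n)) :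
    HasFDerivAt (fun x : EuclideanSpace ℝ (Fin n) => (max (mpF n R x) 0) ^ 2 * (-(6 / R ^ 2) * x i))
      ((max (mpF n R x) 0) ^ 2 • (-(6 / R ^ 2)) • (EuclideanSpace.proj i : (EuclideanSpace ℝ (Fin n)) →L[ℝ] ℝ) +
        (-(6 / R ^ 2) * x i) • ((((0 : ℕ) : ℝ) + 2) * (max (mpF n R x) 0) ^ (0 + 1)) •
          ((-(2 / R ^ 2)) • innerSL ℝ x)) x := by
  have h1 := mp_rhoF_fderiv n R 0 x
  have h2 : HasFDerivAt (fun x : EuclideanSpace ℝ (Fin n) => -(6 / R ^ 2) * x i)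
      ((-(6 / R ^ 2)) • (EuclideanSpace.proj i : (EuclideanSpace ℝ (Fin n)) →L[ℝ] ℝ)) x :=
    (EuclideanSpace.proj i : (EuclideanSpace ℝ (Fin n)) →L[ℝ] ℝ).hasFDerivAt.const_mul _
  exact h1.mul h2

theorem mp_phi_d2 (n : ℕ) (R : ℝ) (i : Fin n) :
    (fun x : EuclideanSpace ℝ (Fin n) => fderiv ℝ (fun x : EuclideanSpace ℝ (Fin n) => (max (mpF n R x) 0) ^ 2 * (-(6 / R ^ 2) * x i)) x
      (EuclideanSpace.single i 1)) =
      fun x => 24 / R ^ 4 * (x i) ^ 2 * max (mpF n R x) 0 - 6 / R ^ 2 * (max (mpF n R x) 0) ^ 2 := by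
  funext x
  rw [(mp_phi_d1_has n R i x).fderiv]
  simp [EuclideanSpace.inner_single_right]
  ring

theorem mp_cutoff_supp (n : ℕ) (R : ℝ) (hR : 0 < R) (x : EuclideanSpace ℝ (Fin n)) (hx : x ∉ Metric.closedBall (0 : EuclideanSpace ℝ (Fin n)) R) :
    max (mpF n R x) 0 = 0 := by
  apply max_eq_right
  rw [mem_closedBall_zero_iff, not_le] at hx
  unfold mpF
  rw [sub_nonpos, one_le_div (by positivity)]
  exact pow_le_pow_left₀ hR.le hx.le 2

/-- integrability of anything continuous multiplied by the cutoff. -/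
theorem mp_cutoff_int (n : ℕ) (R : ℝ) (hR : 0 < R) (f : (EuclideanSpace ℝ (Fin n)) → ℝ) (hf : Continuous f)
    (h0 : ∀ x, max (mpF n R x) 0 = 0 → f x = 0) : Integrable f := by
  apply hf.integrable_of_hasCompactSupport
  refine HasCompactSupport.intro (isCompact_closedBall (0 : EuclideanSpace ℝ (Fin n)) R) fun x hx => ?_
  exact h0 x (mp_cutoff_supp n R hR x hx)

theorem mp_ibp (n : ℕ) (R : ℝ) (hR : 0 < R) (u : (EuclideanSpace ℝ (Fin n)) → ℝ) (hu : ContDiff ℝ 2 u) (i : Fin n) :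
    ∫ x, (max (mpF n R x) 0) ^ 3 *
      fderiv ℝ (fun y => fderiv ℝ u y (EuclideanSpace.single i 1)) x (EuclideanSpace.single i 1) =
    ∫ x, (24 / R ^ 4 * (x i) ^ 2 * max (mpF n R x) 0 - 6 / R ^ 2 * (max (mpF n R x) 0) ^ 2) * u x := by
  have hc1 := mp_c1 n u hu (EuclideanSpace.single i 1)
  have cF := mpF_cont n R
  have c0 : Continuous u := hu.continuous
  have c1 : Continuous (fun y => fderiv ℝ u y (EuclideanSpace.single i 1)) := hc1.continuous
  have c2 : Continuous (fun x => fderiv ℝ (fun y => fderiv ℝ u y (EuclideanSpace.single i 1)) x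
      (EuclideanSpace.single i 1)) :=
    (hc1.continuous_fderiv (by norm_num)).clm_apply continuous_const
  have e1 := fun x => congrFun (mp_phi_d1 n R i) x
  have e2 := fun x => congrFun (mp_phi_d2 n R i) x
  simp only at e1 e2
  have s1 := integral_mul_fderiv_eq_neg_fderiv_mul_of_integrable (μ := (volume : Measure (EuclideanSpace ℝ (Fin n))))
    (f := fun x => (max (mpF n R x) 0) ^ 3)
    (g := fun y => fderiv ℝ u y (EuclideanSpace.single i 1)) (v := EuclideanSpace.single i 1)
    (by
      simp only [e1]
      exact mp_cutoff_int n R hR _ (by fun_prop) (fun x hx => by simp [hx]))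
    (mp_cutoff_int n R hR _ (by fun_prop) (fun x hx => by simp [hx]))
    (mp_cutoff_int n R hR _ (by fun_prop) (fun x hx => by simp [hx]))
    (fun x _ => (mp_rhoF_fderiv n R 1 x).differentiableAt)
    (fun x _ => hc1.differentiable (by norm_num) x)
  have s2 := integral_mul_fderiv_eq_neg_fderiv_mul_of_integrable (μ := (volume : Measure (EuclideanSpace ℝ (Fin n))))
    (f := fun x => (max (mpF n R x) 0) ^ 2 * (-(6 / R ^ 2) * x i))
    (g := u) (v := EuclideanSpace.single i 1)
    (by
      simp only [e2]
      exact mp_cutoff_int n R hR _ (by fun_prop) (fun x hx => by simp [hx]))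
    (mp_cutoff_int n R hR _ (by fun_prop) (fun x hx => by simp [hx]))
    (mp_cutoff_int n R hR _ (by fun_prop) (fun x hx => by simp [hx]))
    (fun x _ => (mp_phi_d1_has n R i x).differentiableAt)
    (fun x _ => hu.differentiable (by norm_num) x)
  rw [s1]
  simp only [e1]
  rw [s2]
  simp only [e2, neg_neg]

theorem mp_ibp_lapl (n : ℕ) (R : ℝ) (hR : 0 < R) (u : (EuclideanSpace ℝ (Fin n)) → ℝ) (hu : ContDiff ℝ 2 u) :
    ∫ x, (max (mpF n R x) 0) ^ 3 * lapl n u x =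
    ∫ x, (24 / R ^ 4 * ‖x‖ ^ 2 * max (mpF n R x) 0 - n * (6 / R ^ 2) * (max (mpF n R x) 0) ^ 2) * u x := by
  have cF := mpF_cont n R
  have c0 : Continuous u := hu.continuous
  unfold lapl
  simp only [Finset.mul_sum]
  rw [integral_finsetSum]
  · simp only [mp_ibp n R hR u hu]
    rw [← integral_finsetSum]
    · congr 1
      funext x
      rw [← Finset.sum_mul, Finset.sum_sub_distrib, ← Finset.sum_mul, ← Finset.mul_sum,
        EuclideanSpace.real_norm_sq_eq]
      simp
      ring_nf
      simp
    · intro i _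
      exact mp_cutoff_int n R hR _ (by fun_prop) (fun x hx => by simp [hx])
  · intro i _
    have hc1 := mp_c1 n u hu (EuclideanSpace.single i 1)
    have c2 : Continuous (fun x => fderiv ℝ (fun y => fderiv ℝ u y (EuclideanSpace.single i 1)) x
      (EuclideanSpace.single i 1)) :=
      (hc1.continuous_fderiv (by norm_num)).clm_apply continuous_const
    exact mp_cutoff_int n R hR _ (by fun_prop) (fun x hx => by simp [hx])

theorem mp_lapl_cont (n : ℕ) (u : (EuclideanSpace ℝ (Fin n)) → ℝ) (hu : ContDiff ℝ 2 u) : Continuous (lapl n u) := by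
  unfold lapl
  refine continuous_finsetSum _ fun i _ => ?_
  exact ((mp_c1 n u hu (EuclideanSpace.single i 1)).continuous_fderiv (by norm_num)).clm_apply
    continuous_const

theorem mp_lapl_phi_ge (n : ℕ) (R : ℝ) (hR : 1 ≤ R) (x : EuclideanSpace ℝ (Fin n)) :
    -((n : ℝ) + 4) ^ 2 * (max (mpF n R x) 0) ^ 3 ≤
    24 / R ^ 4 * ‖x‖ ^ 2 * max (mpF n R x) 0 - n * (6 / R ^ 2) * (max (mpF n R x) 0) ^ 2 := by
  rcases le_total (mpF n R x) 0 with h | h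
  · rw [max_eq_right h]; simp
  · rw [max_eq_left h]
    have hx : ‖x‖ ^ 2 = R ^ 2 * (1 - mpF n R x) := by
      unfold mpF; field_simp; ring
    set f := mpF n R x
    have hR2 : 1 ≤ R ^ 2 := by nlinarith
    have hr : 1 / R ^ 2 ≤ 1 := by rw [div_le_one (by positivity)]; exact hR2
    have hr0 : 0 ≤ 1 / R ^ 2 := by positivity
    have e : 24 / R ^ 4 * ‖x‖ ^ 2 * f - n * (6 / R ^ 2) * f ^ 2 =
        (1 / R ^ 2) * (f * (24 - (24 + 6 * n) * f)) := by
      rw [hx]; field_simp; ring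
    rw [e]
    have key : 0 ≤ 24 - (24 + 6 * (n : ℝ)) * f + ((n : ℝ) + 4) ^ 2 * f ^ 2 := by
      nlinarith [sq_nonneg (((n : ℝ) + 4) * f - 3), sq_nonneg f]
    have h2 : 0 ≤ (1 / R ^ 2) * (f * (24 - (24 + 6 * (n : ℝ)) * f + ((n : ℝ) + 4) ^ 2 * f ^ 2)) :=
      mul_nonneg hr0 (mul_nonneg h key)
    have h3 : (1 / R ^ 2) * (((n : ℝ) + 4) ^ 2 * f ^ 3) ≤ 1 * (((n : ℝ) + 4) ^ 2 * f ^ 3) :=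
      mul_le_mul_of_nonneg_right hr (by positivity)
    nlinarith

theorem mp_power (p K : ℝ) (hp : 1 < p) (hK : 0 < K) :
    ∃ C : ℝ, 0 ≤ C ∧ ∀ t : ℝ, 0 < t → K * t - C ≤ t ^ p := by
  refine ⟨K * K ^ (1 / (p - 1)), by positivity, fun t ht => ?_⟩
  have hp1 : 0 < p - 1 := by linarith
  rcases le_total t (K ^ (1 / (p - 1))) with h | h
  · have := Real.rpow_pos_of_pos ht p
    nlinarith
  · have h1 : K ≤ t ^ (p - 1) := by
      have := Real.rpow_le_rpow (by positivity) h hp1.le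
      rwa [← Real.rpow_mul hK.le, one_div_mul_cancel hp1.ne', Real.rpow_one] at this
    have h2 : t ^ p = t ^ (p - 1) * t := by
      rw [← Real.rpow_add_one ht.ne']; congr 1; ring
    have h3 : 0 ≤ K * K ^ (1 / (p - 1)) := by positivity
    rw [h2]
    nlinarith

theorem mp_ball_bound (n : ℕ) (p : ℝ) (hp : 1 < p) (u : (EuclideanSpace ℝ (Fin n)) → ℝ) (hu : ContDiff ℝ 2 u)
    (hpos : ∀ x, 0 < u x) (heq : ∀ x, -(lapl n u x) + u x = u x ^ p) :
    ∃ C : ℝ, 0 ≤ C ∧ ∀ R : ℝ, 1 ≤ R → ∫ x in Metric.closedBall (0 : EuclideanSpace ℝ (Fin n)) R, u x ≤ C * R ^ n := by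
  obtain ⟨C, hC, hpw⟩ := mp_power p (((n : ℝ) + 4) ^ 2 + 2) hp (by positivity)
  set B : ℝ := volume.real (Metric.closedBall (0 : EuclideanSpace ℝ (Fin n)) 1) with hB
  have hB0 : 0 ≤ B := measureReal_nonneg
  refine ⟨4 * C * 2 ^ n * B, by positivity, fun R hR => ?_⟩
  have hR0 : 0 < 2 * R := by linarith
  have cF := mpF_cont n (2 * R)
  have c0 : Continuous u := hu.continuous
  have cl := mp_lapl_cont n u hu
  set φ : (EuclideanSpace ℝ (Fin n)) → ℝ := fun x => (max (mpF n (2 * R) x) 0) ^ 3 with hφ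
  have hφ0 : ∀ x, 0 ≤ φ x := fun x => pow_nonneg (le_max_right _ _) 3
  have cφ : Continuous φ := by fun_prop
  have iφ : Integrable φ := mp_cutoff_int n (2 * R) hR0 _ (by fun_prop) (fun x hx => by simp [hφ, hx])
  have iφu : Integrable fun x => φ x * u x :=
    mp_cutoff_int n (2 * R) hR0 _ (by fun_prop) (fun x hx => by simp [hφ, hx])
  have iφl : Integrable fun x => φ x * lapl n u x :=
    mp_cutoff_int n (2 * R) hR0 _ (by fun_prop) (fun x hx => by simp [hφ, hx])
  have h1 : ∫ x, φ x * lapl n u x ≤ (C * ∫ x, φ x) - (((n : ℝ) + 4) ^ 2 + 1) * ∫ x, φ x * u x := by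
    rw [← integral_const_mul, ← integral_const_mul, ← integral_sub (iφ.const_mul _) (iφu.const_mul _)]
    refine integral_mono iφl ((iφ.const_mul _).sub (iφu.const_mul _)) fun x => ?_
    have := hpw (u x) (hpos x)
    have e := heq x
    have : lapl n u x ≤ C - (((n : ℝ) + 4) ^ 2 + 1) * u x := by linarith
    have := mul_le_mul_of_nonneg_left this (hφ0 x)
    simp only
    linarith
  have h2 : -((n : ℝ) + 4) ^ 2 * ∫ x, φ x * u x ≤ ∫ x, φ x * lapl n u x := by
    rw [mp_ibp_lapl n (2 * R) hR0 u hu, ← integral_const_mul]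
    refine integral_mono (iφu.const_mul _) ?_ fun x => ?_
    · exact mp_cutoff_int n (2 * R) hR0 _ (by fun_prop) (fun x hx => by simp [hx])
    · have := mul_le_mul_of_nonneg_right (mp_lapl_phi_ge n (2 * R) (by linarith) x) (hpos x).le
      simp only [hφ]
      linarith
  have h3 : ∫ x, φ x * u x ≤ C * ∫ x, φ x := by linarith
  have h4 : ∫ x, φ x ≤ (2 * R) ^ n * B := by
    have hz : ∀ x, x ∉ Metric.closedBall (0 : EuclideanSpace ℝ (Fin n)) (2 * R) → φ x = 0 := fun x hx => by
      simp only [hφ, mp_cutoff_supp n (2 * R) hR0 x hx]; norm_num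
    rw [← setIntegral_eq_integral_of_forall_compl_eq_zero hz]
    have hv := Measure.addHaar_real_closedBall' (volume : Measure (EuclideanSpace ℝ (Fin n))) (0 : EuclideanSpace ℝ (Fin n)) hR0.le
    have : ∫ x in Metric.closedBall (0 : EuclideanSpace ℝ (Fin n)) (2 * R), φ x ≤
        ∫ x in Metric.closedBall (0 : EuclideanSpace ℝ (Fin n)) (2 * R), (1 : ℝ) := by
      refine setIntegral_mono iφ.integrableOn ?_ fun x => ?_
      · exact (continuous_const.continuousOn).integrableOn_compact (isCompact_closedBall _ _)
      · have : max (mpF n (2 * R) x) 0 ≤ 1 := by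
          refine max_le ?_ zero_le_one
          unfold mpF
          have : 0 ≤ ‖x‖ ^ 2 / (2 * R) ^ 2 := by positivity
          linarith
        exact pow_le_one₀ (le_max_right _ _) this
    refine this.trans ?_
    rw [setIntegral_const, hv]
    simp [hB]
  have h5 : (1 / 4) * ∫ x in Metric.closedBall (0 : EuclideanSpace ℝ (Fin n)) R, u x ≤ ∫ x, φ x * u x := by
    rw [← integral_const_mul]
    refine le_trans ?_ (setIntegral_le_integral (s := Metric.closedBall (0 : EuclideanSpace ℝ (Fin n)) R) iφu
      (Eventually.of_forall fun x => mul_nonneg (hφ0 x) (hpos x).le))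
    refine setIntegral_mono_on ?_ iφu.integrableOn Metric.isClosed_closedBall.measurableSet fun x hx => ?_
    · exact (continuous_const.mul c0).continuousOn.integrableOn_compact (isCompact_closedBall _ _)
    · refine mul_le_mul_of_nonneg_right ?_ (hpos x).le
      rw [mem_closedBall_zero_iff] at hx
      have hf : 3 / 4 ≤ mpF n (2 * R) x := by
        unfold mpF
        have : ‖x‖ ^ 2 / (2 * R) ^ 2 ≤ 1 / 4 := by
          rw [div_le_iff₀ (by positivity)]
          nlinarith [norm_nonneg x]
        linarith
      have h6 : 3 / 4 ≤ max (mpF n (2 * R) x) 0 := le_max_of_le_left hf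
      have := pow_le_pow_left₀ (by norm_num) h6 3
      simp only [hφ]
      refine le_trans ?_ this
      norm_num
  have h6 : C * ∫ x, φ x ≤ C * ((2 * R) ^ n * B) := mul_le_mul_of_nonneg_left h4 hC
  rw [mul_pow] at h6
  nlinarith
/-- ball growth implies weighted integrability (dyadic decomposition). -/
theorem mp_weight_of_ball (n : ℕ) (q : ℝ) (hq : (n : ℝ) < q) (u : (EuclideanSpace ℝ (Fin n)) → ℝ) (hu : Continuous u)
    (hpos : ∀ x, 0 < u x) (C : ℝ) (hC : 0 ≤ C)
    (hb : ∀ R : ℝ, 1 ≤ R → ∫ x in Metric.closedBall (0 : EuclideanSpace ℝ (Fin n)) R, u x ≤ C * R ^ n) :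
    Integrable (fun y : EuclideanSpace ℝ (Fin n) => u y * (1 + ‖y‖) ^ (-q)) := by
  have hq0 : 0 < q := lt_of_le_of_lt (Nat.cast_nonneg n) hq
  have hcont : Continuous (fun y : EuclideanSpace ℝ (Fin n) => u y * (1 + ‖y‖) ^ (-q)) := by
    refine hu.mul (Continuous.rpow_const (by fun_prop) fun y => Or.inl ?_)
    positivity
  have hnn : ∀ y : EuclideanSpace ℝ (Fin n), 0 ≤ u y * (1 + ‖y‖) ^ (-q) := fun y =>
    mul_nonneg (hpos y).le (Real.rpow_nonneg (by positivity) _)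
  refine ⟨hcont.aestronglyMeasurable, ?_⟩
  rw [hasFiniteIntegral_iff_ofReal (Eventually.of_forall hnn)]
  set c : ℕ → ℝ := fun k => 2 ^ q * ((2 : ℝ) ^ k) ^ (-q) with hc
  have hc0 : ∀ k, 0 ≤ c k := fun k => by positivity
  set f : ℕ → (EuclideanSpace ℝ (Fin n)) → ENNReal := fun k y =>
    (Metric.closedBall (0 : EuclideanSpace ℝ (Fin n)) (2 ^ k)).indicator (fun y => ENNReal.ofReal (c k * u y)) y with hf
  have hpt : ∀ y : EuclideanSpace ℝ (Fin n), ENNReal.ofReal (u y * (1 + ‖y‖) ^ (-q)) ≤ ∑' k, f k y := by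
    intro y
    obtain ⟨m, hm1, hm2⟩ := exists_nat_pow_near (x := 1 + ‖y‖) (y := (2 : ℝ))
      (by linarith [norm_nonneg y]) (by norm_num)
    refine le_trans ?_ (ENNReal.le_tsum (m + 1))
    have hmem : y ∈ Metric.closedBall (0 : EuclideanSpace ℝ (Fin n)) (2 ^ (m + 1)) := by
      rw [mem_closedBall_zero_iff]; linarith
    simp only [hf, indicator_of_mem hmem]
    apply ENNReal.ofReal_le_ofReal
    rw [mul_comm]
    refine mul_le_mul_of_nonneg_right ?_ (hpos y).le
    have e : c (m + 1) = ((2 : ℝ) ^ m) ^ (-q) := by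
      simp only [hc]
      rw [pow_succ, Real.mul_rpow (by positivity) (by norm_num), mul_left_comm,
        ← Real.rpow_add (by norm_num)]
      simp
    rw [e]
    exact Real.rpow_le_rpow_of_nonpos (by positivity) hm1 (by linarith)
  have hint : ∀ k, ∫⁻ y, f k y ≤ ENNReal.ofReal (2 ^ q * C * ((2 : ℝ) ^ ((n : ℝ) - q)) ^ k) := by
    intro k
    simp only [hf]
    rw [lintegral_indicator Metric.isClosed_closedBall.measurableSet]
    have hi : IntegrableOn (fun y => c k * u y) (Metric.closedBall (0 : EuclideanSpace ℝ (Fin n)) (2 ^ k)) :=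
      (continuous_const.mul hu).continuousOn.integrableOn_compact (isCompact_closedBall _ _)
    rw [← ofReal_integral_eq_lintegral_ofReal hi
      (Eventually.of_forall fun y => mul_nonneg (hc0 k) (hpos y).le)]
    apply ENNReal.ofReal_le_ofReal
    rw [integral_const_mul]
    refine (mul_le_mul_of_nonneg_left (hb (2 ^ k) (one_le_pow₀ (by norm_num))) (hc0 k)).trans ?_
    have e : ((2 : ℝ) ^ ((n : ℝ) - q)) ^ k = ((2 : ℝ) ^ k) ^ (-q) * ((2 : ℝ) ^ k) ^ n := by
      rw [← Real.rpow_natCast ((2 : ℝ) ^ k) n, ← Real.rpow_add (by positivity),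
        ← Real.rpow_natCast, ← Real.rpow_natCast, ← Real.rpow_mul (by norm_num),
        ← Real.rpow_mul (by norm_num)]
      congr 1; ring
    rw [e]
    simp only [hc]
    apply le_of_eq; ring
  refine lt_of_le_of_lt (lintegral_mono hpt) ?_
  rw [lintegral_tsum]
  · refine lt_of_le_of_lt (ENNReal.tsum_le_tsum hint) ?_
    apply Summable.tsum_ofReal_lt_top
    apply Summable.mul_left
    apply summable_geometric_of_lt_one (by positivity)
    exact Real.rpow_lt_one_of_one_lt_of_neg (by norm_num) (by linarith)
  · intro k
    refine (Measurable.indicator ?_ Metric.isClosed_closedBall.measurableSet).aemeasurable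
    have := hu.measurable
    fun_prop

theorem mp_weight (n : ℕ) (s p cns : ℝ) (hs : 0 < s) (hp : 1 < p)
    (u : (EuclideanSpace ℝ (Fin n)) → ℝ) (hu : ContDiff ℝ 2 u) (hpos : ∀ x, 0 < u x) (Lu : (EuclideanSpace ℝ (Fin n)) → ℝ)
    (hLu : ∀ x, IsFracLapAt n s u x (Lu x))
    (heq : ∀ x, -(lapl n u x) + cns * Lu x + u x = u x ^ p) :
    Integrable (fun y : EuclideanSpace ℝ (Fin n) => u y * (1 + ‖y‖) ^ (-((n : ℝ) + 2 * s))) := by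
  by_contra hW
  have hz : ∀ x, Lu x = 0 := fun x => mp_lu_zero n s hs u hu.continuous hW x _ (hLu x)
  obtain ⟨C, hC, hb⟩ := mp_ball_bound n p hp u hu hpos (fun x => by
    have := heq x
    rw [hz x] at this
    linarith)
  exact hW (mp_weight_of_ball n _ (by linarith) u hu.continuous hpos C hC hb)
/-! ### The nonlocal comparison -/

theorem mp_nonlocal (n : ℕ) [NeZero n] (s lam : ℝ) (hs : 0 < s)
    (u : (EuclideanSpace ℝ (Fin n)) → ℝ) (hu : Continuous u)
    (hW : Integrable (fun y : EuclideanSpace ℝ (Fin n) => u y * (1 + ‖y‖) ^ (-((n : ℝ) + 2 * s))))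
    (hge : ∀ x : EuclideanSpace ℝ (Fin n), lam < x 0 → u (reflHyp n lam x) ≤ u x)
    (x z : EuclideanSpace ℝ (Fin n)) (hx : lam < x 0) (hxe : u (reflHyp n lam x) = u x)
    (hz : lam < z 0) (hzne : u (reflHyp n lam z) ≠ u z)
    (L0 L1 : ℝ) (hL0 : IsFracLapAt n s u x L0) (hL1 : IsFracLapAt n s u (reflHyp n lam x) L1) :
    L0 < L1 := by
  set q : ℝ := (n : ℝ) + 2 * s with hq
  have hq0 : 0 < q := by positivity
  set R := reflHyp n lam with hR
  have hmp : MeasurePreserving R (volume : Measure (EuclideanSpace ℝ (Fin n))) volume := mp_refl_mp n lam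
  have hemb : MeasurableEmbedding R := mp_refl_emb n lam
  have hRc : Continuous R := mp_refl_cont n lam
  have hinv : ∀ y, R (R y) = y := mp_refl_invol n lam
  have hd : ∀ a b, dist (R a) b = dist a (R b) := mp_refl_dist' n lam
  set w : (EuclideanSpace ℝ (Fin n)) → ℝ := fun y => u y - u (R y) with hw
  have hwc : Continuous w := by fun_prop
  set A : (EuclideanSpace ℝ (Fin n)) → ℝ → Set (EuclideanSpace ℝ (Fin n)) := fun a ε => {y | ε ≤ dist a y} with hA
  have hAm : ∀ a ε, MeasurableSet (A a ε) := fun a ε => mp_meas_far n a ε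
  have hAR : ∀ a ε, R ⁻¹' (A (R a) ε) = A a ε := by
    intro a ε
    ext y
    simp only [hA, mem_preimage, mem_ofPred_eq, hd, hinv]
  -- integrability
  have iu : ∀ a ε, 0 < ε → IntegrableOn (fun y => u y / dist a y ^ q) (A a ε) := fun a ε hε =>
    mp_far_of_weight n q hq0 u hu hW a ε hε
  have iuR : ∀ a ε, 0 < ε → IntegrableOn (fun y => u (R y) / dist a y ^ q) (A a ε) := by
    intro a ε hε
    have h := (hmp.integrableOn_comp_preimage hemb).2 (iu (R a) ε hε)
    rw [hAR] at h
    refine h.congr_fun (fun y _ => ?_) (hAm a ε)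
    simp only [Function.comp, hd, hinv]
  have iw : ∀ a ε, 0 < ε → IntegrableOn (fun y => w y / dist a y ^ q) (A a ε) := by
    intro a ε hε
    refine IntegrableOn.congr_fun ((iu a ε hε).sub (iuR a ε hε)) (fun y _ => ?_) (hAm a ε)
    simp only [Pi.sub_apply, hw]; ring
  have ic : ∀ (c : ℝ) a ε, 0 < ε → IntegrableOn (fun y => c / dist a y ^ q) (A a ε) := fun c a ε hε =>
    mp_far_of_weight n q hq0 (fun _ => c) continuous_const (mp_const_weight n q (by linarith) c) a ε hε
  -- difference
  have hdiff : ∀ ε, 0 < ε → (∫ y in A (R x) ε, (u (R x) - u y) / dist (R x) y ^ q) -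
      (∫ y in A x ε, (u x - u y) / dist x y ^ q) = ∫ y in A x ε, w y / dist x y ^ q := by
    intro ε hε
    rw [← hmp.setIntegral_preimage_emb hemb, hAR, hxe]
    simp only [hd, hinv]
    rw [← integral_sub]
    · congr 1; funext y; simp only [hw]; ring
    · refine IntegrableOn.congr_fun ((ic (u x) x ε hε).sub (iuR x ε hε)) (fun y _ => ?_) (hAm x ε)
      simp only [Pi.sub_apply]; ring
    · refine IntegrableOn.congr_fun ((ic (u x) x ε hε).sub (iu x ε hε)) (fun y _ => ?_) (hAm x ε)
      simp only [Pi.sub_apply]; ring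
  set P : Set (EuclideanSpace ℝ (Fin n)) := {y | lam < y 0} with hP
  have hcoord : Continuous fun y : EuclideanSpace ℝ (Fin n) => y 0 := by fun_prop
  have hPo : IsOpen P := isOpen_lt continuous_const hcoord
  have hPm : MeasurableSet P := hPo.measurableSet
  have hR0 : ∀ y : EuclideanSpace ℝ (Fin n), (R y) 0 = 2 * lam - y 0 := mp_refl_zero n lam
  have hw0 : ∀ y ∈ P, 0 ≤ w y := fun y hy => sub_nonneg.2 (hge y hy)
  have hdl : ∀ y ∈ P, dist x y < dist (R x) y := fun y hy => mp_dist_lt n lam x y hx hy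
  set d : ℝ := dist (R x) x / 2 with hdd
  have hd0 : 0 < d := by
    have := hdl x hx
    rw [dist_self] at this
    positivity
  have hPsub : P ⊆ A (R x) d := by
    intro y hy
    have h1 := hdl y hy
    have h2 := dist_triangle (R x) y x
    rw [dist_comm y x] at h2
    simp only [hA, mem_ofPred_eq, hdd]
    linarith
  set F : (EuclideanSpace ℝ (Fin n)) → ℝ := fun y => w y / dist (R x) y ^ q with hF
  have iF : IntegrableOn F P := (iw (R x) d hd0).mono_set hPsub
  have hJ : ∀ ε, 0 < ε → ε ≤ d → ∫ y in A x ε, w y / dist x y ^ q =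
      (∫ y in A x ε ∩ P, w y / dist x y ^ q) - ∫ y in P, F y := by
    intro ε hε hεd
    rw [← integral_inter_add_diff hPm (iw x ε hε), sub_eq_add_neg]
    congr 1
    set N : Set (EuclideanSpace ℝ (Fin n)) := {y | y 0 < lam} with hN
    have hNm : MeasurableSet N := (isOpen_lt hcoord continuous_const).measurableSet
    have e1 : ∫ y in A x ε \ P, w y / dist x y ^ q = ∫ y in A x ε ∩ N, w y / dist x y ^ q := by
      refine setIntegral_eq_of_subset_of_forall_diff_eq_zero ((hAm x ε).diff hPm) ?_ ?_
      · rintro y ⟨h1, h2⟩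
        refine ⟨h1, fun h3 => ?_⟩
        simp only [hN, hP, mem_ofPred_eq] at h2 h3
        linarith
      · rintro y ⟨⟨h1, h2⟩, h3⟩
        have hy : y 0 = lam := by
          by_contra hne
          rcases lt_or_gt_of_ne hne with h | h
          · exact h3 ⟨h1, h⟩
          · exact h2 h
        have : R y = y := by
          simp only [hR, reflHyp, hy]; simp
        simp only [hw, this, sub_self, zero_div]
    have e2 : A x ε ∩ N = R ⁻¹' (A (R x) ε ∩ P) := by
      rw [preimage_inter, hAR]
      congr 1
      ext y
      simp only [hN, hP, mem_preimage, mem_ofPred_eq, hR0]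
      constructor <;> intro h <;> linarith
    have e3 : A (R x) ε ∩ P = P := by
      refine inter_eq_right.2 fun y hy => ?_
      have := hPsub hy
      simp only [hA, mem_ofPred_eq] at this ⊢
      linarith
    have e4 : ∀ y, w y / dist x y ^ q = - F (R y) := by
      intro y
      simp only [hF, hw, hd, hinv]; ring
    rw [e1, e2]
    simp only [e4]
    rw [hmp.setIntegral_preimage_emb hemb (fun y => - F y), e3, integral_neg]
  -- the positive quantity
  have hwz : 0 < w z := sub_pos.2 (lt_of_le_of_ne (hge z hz) hzne)
  have hxz : 0 < dist x z := by
    rw [dist_pos]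
    rintro rfl
    exact hzne hxe
  set δ : ℝ := dist x z / 2 with hδ
  have hδ0 : 0 < δ := by positivity
  set G : (EuclideanSpace ℝ (Fin n)) → ℝ := fun y => w y / dist x y ^ q - F y with hG
  have iG : ∀ ε, 0 < ε → IntegrableOn G (A x ε ∩ P) := fun ε hε =>
    ((iw x ε hε).mono_set inter_subset_left).sub (iF.mono_set inter_subset_right)
  have hkk : ∀ ε, 0 < ε → ∀ y ∈ A x ε ∩ P, (dist (R x) y ^ q)⁻¹ < (dist x y ^ q)⁻¹ := by
    rintro ε hε y ⟨h1, h2⟩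
    have h3 : 0 < dist x y := lt_of_lt_of_le hε h1
    have := Real.rpow_lt_rpow h3.le (hdl y h2) hq0
    exact (inv_lt_inv₀ (Real.rpow_pos_of_pos (h3.trans (hdl y h2)) _) (Real.rpow_pos_of_pos h3 _)).2 this
  have hGe : ∀ y, G y = w y * ((dist x y ^ q)⁻¹ - (dist (R x) y ^ q)⁻¹) := fun y => by
    simp only [hG, hF]; ring
  have hG0 : ∀ ε, 0 < ε → ∀ y ∈ A x ε ∩ P, 0 ≤ G y := by
    intro ε hε y hy
    rw [hGe]
    exact mul_nonneg (hw0 y hy.2) (sub_pos.2 (hkk ε hε y hy)).le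
  have hm : ∀ ε, MeasurableSet (A x ε ∩ P) := fun ε => (hAm x ε).inter hPm
  set κ : ℝ := ∫ y in A x δ ∩ P, G y with hκ
  have hκ0 : 0 < κ := by
    rw [hκ, setIntegral_pos_iff_support_of_nonneg_ae
      ((ae_restrict_iff' (hm δ)).2 (Eventually.of_forall (hG0 δ hδ0))) (iG δ hδ0)]
    have hopen : IsOpen ({y : EuclideanSpace ℝ (Fin n) | δ < dist x y} ∩ P ∩ {y | 0 < w y}) :=
      ((isOpen_lt continuous_const (by fun_prop)).inter hPo).inter
        (isOpen_lt continuous_const hwc)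
    refine lt_of_lt_of_le (hopen.measure_pos volume ⟨z, ⟨⟨?_, hz⟩, hwz⟩⟩) (measure_mono ?_)
    · simp only [mem_ofPred_eq, hδ]; linarith
    · rintro y ⟨⟨h1, h2⟩, h3⟩
      have hy : y ∈ A x δ ∩ P := ⟨(show δ < dist x y from h1).le, h2⟩
      refine ⟨?_, hy⟩
      rw [Function.mem_support, hGe]
      exact (mul_pos h3 (sub_pos.2 (hkk δ hδ0 y hy))).ne'
  -- limits
  have hlim : Tendsto (fun ε : ℝ => ∫ y in A x ε ∩ P, F y) (𝓝[>] 0) (𝓝 (∫ y in P, F y)) := by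
    have e : ∀ ε, ∫ y in A x ε ∩ P, F y = ∫ y in P, (A x ε).indicator F y := by
      intro ε
      rw [setIntegral_indicator (hAm x ε), inter_comm]
    simp only [e]
    refine tendsto_integral_filter_of_dominated_convergence (fun y => ‖F y‖) ?_ ?_ iF.norm ?_
    · exact Eventually.of_forall fun ε => iF.aestronglyMeasurable.indicator (hAm x ε)
    · exact Eventually.of_forall fun ε => Eventually.of_forall fun y => norm_indicator_le_norm_self _ _
    · have hF0 : F x = 0 := by simp [hF, hw, hxe]
      refine Eventually.of_forall fun y => ?_
      by_cases hy : y = x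
      · subst hy
        have : ∀ ε, (A y ε).indicator F y = F y := by
          intro ε
          by_cases h : y ∈ A y ε
          · rw [indicator_of_mem h]
          · rw [indicator_of_notMem h, hF0]
        simp only [this]
        exact tendsto_const_nhds
      · have hp : 0 < dist x y := dist_pos.2 (Ne.symm hy)
        refine (tendsto_const_nhds (x := F y)).congr' ?_
        filter_upwards [nhdsWithin_le_nhds (gt_mem_nhds hp)] with ε hε
        rw [indicator_of_mem]
        exact le_of_lt hε
  have hsub := hL1.sub hL0
  have hfin : κ + (∫ y in P, F y) - ∫ y in P, F y ≤ L1 - L0 := by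
    refine le_of_tendsto_of_tendsto ((hlim.const_add κ).sub_const _) hsub ?_
    filter_upwards [self_mem_nhdsWithin, nhdsWithin_le_nhds (gt_mem_nhds hd0),
      nhdsWithin_le_nhds (gt_mem_nhds hδ0)] with ε hε hεd hεδ
    have hε0 : 0 < ε := hε
    have h1 := hdiff ε hε0
    rw [hJ ε hε0 hεd.le] at h1
    refine le_of_le_of_eq ?_ h1.symm
    have h2 : ∫ y in A x ε ∩ P, G y =
        (∫ y in A x ε ∩ P, w y / dist x y ^ q) - ∫ y in A x ε ∩ P, F y :=
      integral_sub ((iw x ε hε0).mono_set inter_subset_left) (iF.mono_set inter_subset_right)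
    have h3 : κ ≤ ∫ y in A x ε ∩ P, G y := by
      refine setIntegral_mono_set (iG ε hε0)
        ((ae_restrict_iff' (hm ε)).2 (Eventually.of_forall (hG0 ε hε0))) ?_
      refine (inter_subset_inter_left P fun y hy => ?_).eventuallyLE
      exact le_trans hεδ.le hy
    linarith
  linarith
/-- moving plane step. If a positive classical solution `u` of
`−Δu + (−Δ)ˢu + u = uᵖ` satisfies `u ≥ u_λ` on the half-space `Σ_λ = {x₁ > λ}` but
`u ≢ u_λ` there, then `u > u_λ` strictly in `Σ_λ`. -/
theorem moving_plane_strict (n : ℕ) [NeZero n] (hn : 2 ≤ n) (s p cns lam : ℝ)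
    (hs : s ∈ Set.Ioo (0 : ℝ) 1) (hp : 1 < p) (hcns : 0 < cns)
    (u : EuclideanSpace ℝ (Fin n) → ℝ) (hu2 : ContDiff ℝ 2 u)
    (hupos : ∀ x : EuclideanSpace ℝ (Fin n), 0 < u x)
    (Lu : EuclideanSpace ℝ (Fin n) → ℝ)
    (hLu : ∀ x : EuclideanSpace ℝ (Fin n), IsFracLapAt n s u x (Lu x))
    (heq : ∀ x : EuclideanSpace ℝ (Fin n), -(lapl n u x) + cns * Lu x + u x = u x ^ p)
    (hge : ∀ x : EuclideanSpace ℝ (Fin n), lam < x 0 → u (reflHyp n lam x) ≤ u x)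
    (hne : ¬ ∀ x : EuclideanSpace ℝ (Fin n), lam < x 0 → u (reflHyp n lam x) = u x) :
    ∀ x : EuclideanSpace ℝ (Fin n), lam < x 0 → u (reflHyp n lam x) < u x := by
  intro x hx
  refine lt_of_le_of_ne (hge x hx) fun hxe => ?_
  push Not at hne
  obtain ⟨z, hz, hzne⟩ := hne
  have hW := mp_weight n s p cns hs.1 hp u hu2 hupos Lu hLu heq
  have h1 := mp_nonlocal n s lam hs.1 u hu2.continuous hW hge x z hx hxe hz hzne
    (Lu x) (Lu (reflHyp n lam x)) (hLu _) (hLu _)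
  have h2 := mp_lapl_le n lam u hu2 x hx hxe hge
  have e0 := heq x
  have e1 := heq (reflHyp n lam x)
  rw [hxe] at e1
  have h3 := mul_lt_mul_of_pos_left h1 hcns
  linarith
end
end
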